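/- If p+q is even and 3 ≤ p ≤ q, then the initial two-color Babylon position consisting of p red singleton stacks and q blue singleton stacks is not a first-player win, i.e., the second player (Bob) has a winning strategy. -/

import Mathlib

/-- A chip color: `true` = red, `false` = blue.  A stack is a nonempty list of
chips, the head of the list being the top chip; the color of a stack is the
color of its top chip.  A position is a finite multiset of stacks. -/
abbrev Stack := List Bool

abbrev Position := Multiset Stack

/-- A legal move replaces two stacks `s` and `t` that have equal length or
equal top color by the single concatenated stack `s ++ t`. -/
def Move (P Q : Position) : Prop :=
  ∃ s t : Stack, s ≠ [] ∧ t ≠ [] ∧ s ∈ P ∧ t ∈ P.erase s ∧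
    (s.length = t.length ∨ s.head? = t.head?) ∧
    Q = (s ++ t) ::ₘ (P.erase s).erase t

/-- Auxiliary predicate, with the number of stacks as fuel: the player to move
wins iff there is a legal move to a position that is not a first-player win. -/
def FirstWinAux : ℕ → Position → Prop
  | 0, _ => False
  | n + 1, P => ∃ Q, Move P Q ∧ ¬ FirstWinAux n Q

/-- The position is a first-player win: the player to move has a winning
strategy.  Since each move decreases the number of stacks by exactly one,
`Multiset.card P` is enough fuel. -/
def FirstWin (P : Position) : Prop := FirstWinAux (Multiset.card P) P

/-- The initial position with `p` red singleton stacks and `q` blue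
singleton stacks. -/
def initPos (p q : ℕ) : Position :=
  Multiset.replicate p [true] + Multiset.replicate q [false]

/-- `Merge S T`: the multiset of heights `T` arises from `S` by adding up two of its members. -/
def Merge (S T : Multiset ℕ) : Prop :=
  ∃ a b U, S = a ::ₘ b ::ₘ U ∧ T = (a + b) ::ₘ U

mutual

/-- `Lose R B`: with red heights `R` and blue heights `B`, the player to move loses. -/
inductive Lose : Multiset ℕ → Multiset ℕ → Prop
  | intro (R B : Multiset ℕ)
      (red : ∀ R', Merge R R' → Win R' B)
      (blue : ∀ B', Merge B B' → Win R B')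
      (mixRed : ∀ s T U, R = s ::ₘ T → B = s ::ₘ U → Win ((s + s) ::ₘ T) U)
      (mixBlue : ∀ s T U, R = s ::ₘ T → B = s ::ₘ U → Win T ((s + s) ::ₘ U)) : Lose R B

/-- `Win R B`: with red heights `R` and blue heights `B`, the player to move wins. -/
inductive Win : Multiset ℕ → Multiset ℕ → Prop
  | red {R R' B : Multiset ℕ} : Merge R R' → Lose R' B → Win R B
  | blue {R B B' : Multiset ℕ} : Merge B B' → Lose R B' → Win R B
  | mixRed {R B : Multiset ℕ} (s : ℕ) {R' B' : Multiset ℕ} :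
      R = s ::ₘ R' → B = s ::ₘ B' → Lose ((s + s) ::ₘ R') B' → Win R B
  | mixBlue {R B : Multiset ℕ} (s : ℕ) {R' B' : Multiset ℕ} :
      R = s ::ₘ R' → B = s ::ₘ B' → Lose R' ((s + s) ::ₘ B') → Win R B

end

theorem Merge.card {S T : Multiset ℕ} (h : Merge S T) : S.card = T.card + 1 := by
  obtain ⟨a, b, U, rfl, rfl⟩ := h
  simp

theorem lose_win_symm (n : ℕ) : ∀ R B : Multiset ℕ, R.card + B.card = n →
    (Lose R B → Lose B R) ∧ (Win R B → Win B R) := by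
  induction n using Nat.strong_induction_on with
  | _ n ih =>
    intro R B hn
    refine ⟨fun h => ?_, fun h => ?_⟩
    · obtain ⟨_, _, h1, h2, h3, h4⟩ := h
      refine .intro _ _ (fun B' hB => ?_) (fun R' hR => ?_) (fun s B' R' hB hR => ?_)
        (fun s B' R' hB hR => ?_)
      · exact (ih _ (by have := hB.card; omega) R B' rfl).2 (h2 _ hB)
      · exact (ih _ (by have := hR.card; omega) R' B rfl).2 (h1 _ hR)
      · refine (ih _ ?_ _ _ rfl).2 (h4 s R' B' hR hB)
        subst hR hB
        simp only [Multiset.card_cons] at hn ⊢; omega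
      · refine (ih _ ?_ _ _ rfl).2 (h3 s R' B' hR hB)
        subst hR hB
        simp only [Multiset.card_cons] at hn ⊢; omega
    · cases h with
      | red hm hl => exact .blue hm ((ih _ (by have := hm.card; omega) _ _ rfl).1 hl)
      | blue hm hl => exact .red hm ((ih _ (by have := hm.card; omega) _ _ rfl).1 hl)
      | mixRed s hR hB hl =>
        refine .mixBlue s hB hR ((ih _ ?_ _ _ rfl).1 hl)
        subst hR hB
        simp only [Multiset.card_cons] at hn ⊢; omega
      | mixBlue s hR hB hl =>
        refine .mixRed s hB hR ((ih _ ?_ _ _ rfl).1 hl)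
        subst hR hB
        simp only [Multiset.card_cons] at hn ⊢; omega

theorem Lose.symm {R B : Multiset ℕ} (h : Lose R B) : Lose B R :=
  (lose_win_symm _ R B rfl).1 h

theorem Win.symm {R B : Multiset ℕ} (h : Win R B) : Win B R :=
  (lose_win_symm _ R B rfl).2 h

/-! ### The translation between positions and pairs of multisets of heights -/

/-- The heights of the stacks of color `c`. -/
def heights (c : Bool) (P : Position) : Multiset ℕ :=
  (P.filter fun s => s.head? = some c).map List.length

theorem heights_cons_self {c : Bool} {s : Stack} (P : Position) (h : s.head? = some c) :
    heights c (s ::ₘ P) = s.length ::ₘ heights c P := by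
  simp [heights, h]

theorem heights_cons_of_ne {c : Bool} {s : Stack} (P : Position) (h : s.head? ≠ some c) :
    heights c (s ::ₘ P) = heights c P := by
  simp [heights, h]

theorem exists_of_heights_eq_cons {c : Bool} {P : Position} {a : ℕ} {U : Multiset ℕ}
    (h : heights c P = a ::ₘ U) :
    ∃ s P', P = s ::ₘ P' ∧ s.head? = some c ∧ s.length = a ∧ heights c P' = U := by
  have ha : a ∈ heights c P := h ▸ Multiset.mem_cons_self a U
  simp only [heights, Multiset.mem_map, Multiset.mem_filter] at ha
  obtain ⟨s, ⟨hs, hc⟩, hl⟩ := ha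
  obtain ⟨P', rfl⟩ := Multiset.exists_cons_of_mem hs
  rw [heights_cons_self _ hc, hl] at h
  exact ⟨s, P', rfl, hc, hl, (Multiset.cons_inj_right a).1 h⟩

theorem move_iff {P Q : Position} : Move P Q ↔
    ∃ s t P', s ≠ [] ∧ t ≠ [] ∧ P = s ::ₘ t ::ₘ P' ∧
      (s.length = t.length ∨ s.head? = t.head?) ∧ Q = (s ++ t) ::ₘ P' := by
  constructor
  · rintro ⟨s, t, hs, ht, hsP, htP, h, rfl⟩
    exact ⟨s, t, _, hs, ht, by rw [Multiset.cons_erase htP, Multiset.cons_erase hsP], h, rfl⟩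
  · rintro ⟨s, t, P', hs, ht, rfl, h, rfl⟩
    exact ⟨s, t, hs, ht, by simp, by simp, h, by simp⟩

theorem head?_append_of_eq {s : Stack} {c : Bool} (h : s.head? = some c) (t : Stack) :
    (s ++ t).head? = some c := by
  cases s <;> simp_all

/-- The red and the blue heights determine the outcome of a position. -/
theorem firstWinAux_of_heights (n : ℕ) : ∀ P : Position, Multiset.card P = n →
    (∀ s ∈ P, s ≠ []) →
    (Lose (heights true P) (heights false P) → ¬ FirstWinAux n P) ∧
    (Win (heights true P) (heights false P) → FirstWinAux n P) := by
  induction n with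
  | zero =>
    intro P hP hne
    obtain rfl := Multiset.card_eq_zero.1 hP
    refine ⟨fun _ h => h, fun h => ?_⟩
    cases h with
    | red hm => simpa [heights] using hm.card
    | blue hm => simpa [heights] using hm.card
    | mixRed s hR => simp [heights] at hR
    | mixBlue s hR => simp [heights] at hR
  | succ n ih =>
    intro P hP hne
    refine ⟨fun hl hw => ?_, fun hw => ?_⟩
    · obtain ⟨Q, hm, hQ⟩ := hw
      obtain ⟨s, t, P', hs, ht, rfl, hst, rfl⟩ := move_iff.1 hm
      have hq := ih ((s ++ t) ::ₘ P') (by simpa using hP) (by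
        intro u hu
        rcases Multiset.mem_cons.1 hu with rfl | hu
        · simp [hs]
        · exact hne u (by simp [hu]))
      refine hQ (hq.2 ?_)
      obtain ⟨_, _, h1, h2, h3, h4⟩ := hl
      rcases hsc : s.head? with _ | _ | _
      · simp [hs] at hsc
      · have e1 := head?_append_of_eq hsc t
        rcases htc : t.head? with _ | _ | _
        · simp [ht] at htc
        · rw [heights_cons_of_ne _ (by simp [e1]), heights_cons_self _ e1]
          rw [heights_cons_self _ hsc, heights_cons_self _ htc,
            heights_cons_of_ne (c := true) _ (by simp [hsc]),
            heights_cons_of_ne (c := true) _ (by simp [htc])] at h2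
          exact h2 _ ⟨_, _, _, rfl, by simp⟩
        · rw [heights_cons_of_ne _ (by simp [e1]), heights_cons_self _ e1]
          rw [heights_cons_of_ne _ (by simp [hsc]), heights_cons_self _ htc,
            heights_cons_self _ hsc, heights_cons_of_ne _ (by simp [htc])] at h4
          have hlen : s.length = t.length := by simpa [hsc, htc] using hst
          have := h4 _ _ _ rfl (by rw [hlen])
          simpa [hlen] using this
      · have e1 := head?_append_of_eq hsc t
        rcases htc : t.head? with _ | _ | _
        · simp [ht] at htc
        · rw [heights_cons_self _ e1, heights_cons_of_ne _ (by simp [e1])]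
          rw [heights_cons_self _ hsc, heights_cons_of_ne _ (by simp [htc]),
            heights_cons_of_ne _ (by simp [hsc]), heights_cons_self _ htc] at h3
          have hlen : s.length = t.length := by simpa [hsc, htc] using hst
          have := h3 _ _ _ rfl (by rw [hlen])
          simpa [hlen] using this
        · rw [heights_cons_self _ e1, heights_cons_of_ne _ (by simp [e1])]
          rw [heights_cons_self _ hsc, heights_cons_self _ htc,
            heights_cons_of_ne _ (by simp [hsc]), heights_cons_of_ne _ (by simp [htc])] at h1
          exact h1 _ ⟨_, _, _, rfl, by simp⟩
    · have key : ∀ s t P', P = s ::ₘ t ::ₘ P' → (s.length = t.length ∨ s.head? = t.head?) →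
          Lose (heights true ((s ++ t) ::ₘ P')) (heights false ((s ++ t) ::ₘ P')) →
          FirstWinAux (n + 1) P := by
        rintro s t P' rfl h hl
        have hs : s ≠ [] := hne s (by simp)
        refine ⟨_, move_iff.2 ⟨s, t, P', hs, hne t (by simp), rfl, h, rfl⟩, ?_⟩
        refine (ih _ (by simpa using hP) ?_).1 hl
        intro u hu
        rcases Multiset.mem_cons.1 hu with rfl | hu
        · simp [hs]
        · exact hne u (by simp [hu])
      have hmix : ∀ (s t : Stack) (P' : Position) (a : ℕ), s.head? = some true → 
          t.head? = some false → s.length = a → t.length = a → P = s ::ₘ t ::ₘ P' →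
          (Lose ((a + a) ::ₘ heights true P') (heights false P') ∨
            Lose (heights true P') ((a + a) ::ₘ heights false P')) → FirstWinAux (n + 1) P := by
        intro s t P' a hs ht hsl htl hP' hl
        rcases hl with hl | hl
        · refine key s t P' hP' (.inl (hsl.trans htl.symm)) ?_
          have e := head?_append_of_eq hs t
          rw [heights_cons_self _ e, heights_cons_of_ne _ (by simp [e])]
          simpa [hsl, htl] using hl
        · refine key t s P' (by rw [hP', Multiset.cons_swap]) (.inl (htl.trans hsl.symm)) ?_
          have e := head?_append_of_eq ht s
          rw [heights_cons_self _ e, heights_cons_of_ne _ (by simp [e])]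
          simpa [hsl, htl] using hl
      have hpick : ∀ (a : ℕ) (R' B' : Multiset ℕ), heights true P = a ::ₘ R' →
          heights false P = a ::ₘ B' → ∃ s t P', s.head? = some true ∧
          t.head? = some false ∧ s.length = a ∧ t.length = a ∧ P = s ::ₘ t ::ₘ P' ∧
          heights true P' = R' ∧ heights false P' = B' := by
        intro a R' B' hR hB
        obtain ⟨s, P₁, rfl, hs, hsl, hR'⟩ := exists_of_heights_eq_cons hR
        rw [heights_cons_of_ne _ (by simp [hs])] at hB
        obtain ⟨t, P₂, rfl, ht, htl, hB'⟩ := exists_of_heights_eq_cons hB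
        rw [heights_cons_of_ne _ (by simp [ht])] at hR'
        exact ⟨s, t, P₂, hs, ht, hsl, htl, rfl, hR', hB'⟩
      cases hw with
      | red hm hl =>
        obtain ⟨a, b, U, hR, rfl⟩ := hm
        obtain ⟨s, P₁, rfl, hs, rfl, hR'⟩ := exists_of_heights_eq_cons hR
        obtain ⟨t, P₂, rfl, ht, rfl, rfl⟩ := exists_of_heights_eq_cons hR'
        refine key s t P₂ rfl (.inr (hs.trans ht.symm)) ?_
        have e := head?_append_of_eq hs t
        rw [heights_cons_self _ e, heights_cons_of_ne _ (by simp [e])]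
        rw [heights_cons_of_ne _ (by simp [hs]), heights_cons_of_ne _ (by simp [ht])] at hl
        simpa using hl
      | blue hm hl =>
        obtain ⟨a, b, U, hR, rfl⟩ := hm
        obtain ⟨s, P₁, rfl, hs, rfl, hR'⟩ := exists_of_heights_eq_cons hR
        obtain ⟨t, P₂, rfl, ht, rfl, rfl⟩ := exists_of_heights_eq_cons hR'
        refine key s t P₂ rfl (.inr (hs.trans ht.symm)) ?_
        have e := head?_append_of_eq hs t
        rw [heights_cons_self _ e, heights_cons_of_ne _ (by simp [e])]
        rw [heights_cons_of_ne _ (by simp [hs]), heights_cons_of_ne _ (by simp [ht])] at hl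
        simpa using hl
      | mixRed a hR hB hl =>
        obtain ⟨s, t, P', hs, ht, hsl, htl, hP', rfl, rfl⟩ := hpick a _ _ hR hB
        exact hmix s t P' a hs ht hsl htl hP' (.inl hl)
      | mixBlue a hR hB hl =>
        obtain ⟨s, t, P', hs, ht, hsl, htl, hP', rfl, rfl⟩ := hpick a _ _ hR hB
        exact hmix s t P' a hs ht hsl htl hP' (.inr hl)

/-! ### One red stack against many blue stacks -/

theorem exists_pair_sum_ne {r : ℕ} {B : Multiset ℕ} (hB : 3 ≤ B.card)
    (hh : ∀ h ∈ B, h + h ≠ r) : ∃ a b U, B = a ::ₘ b ::ₘ U ∧ a + b ≠ r := by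
  obtain ⟨a, B, rfl⟩ := Multiset.card_pos_iff_exists_mem.1 (by omega : 0 < B.card) |>.imp
    fun a ha => Multiset.exists_cons_of_mem ha
  simp only [Multiset.card_cons] at hB
  obtain ⟨b, B, rfl⟩ := Multiset.card_pos_iff_exists_mem.1 (by omega : 0 < B.card) |>.imp
    fun a ha => Multiset.exists_cons_of_mem ha
  simp only [Multiset.card_cons] at hB
  obtain ⟨c, B, rfl⟩ := Multiset.card_pos_iff_exists_mem.1 (by omega : 0 < B.card) |>.imp
    fun a ha => Multiset.exists_cons_of_mem ha
  by_cases h1 : a + b = r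
  · by_cases h2 : a + c = r
    · refine ⟨b, c, a ::ₘ B, ?_, fun h3 => hh a (by simp) (by omega)⟩
      rw [Multiset.cons_swap a b, Multiset.cons_swap a c]
    · exact ⟨a, c, b ::ₘ B, by rw [Multiset.cons_swap b c], h2⟩
  · exact ⟨a, b, c ::ₘ B, rfl, h1⟩

theorem single_aux (n : ℕ) : ∀ (r : ℕ) (B : Multiset ℕ), B.card = n → (∀ b ∈ B, 1 ≤ b) →
    (n % 2 = 0 → 2 ≤ n → B.count r ≤ 1 → r ≠ B.sum → (r = 2 → ∃ b ∈ B, 2 ≤ b) →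
      (4 ≤ n → ∀ h, 2 ≤ h → h + h = r → B.count h ≤ 3) → Win (r ::ₘ 0) B) ∧
    (n % 2 = 1 → r ∉ B → r ≠ B.sum →
      (5 ≤ n → ∀ h, 2 ≤ h → h + h = r → B.count h ≤ 2) → Lose (r ::ₘ 0) B) := by
  induction n with
  | zero => exact fun r B _ _ => ⟨fun _ h => absurd h (by omega), fun h => absurd h (by omega)⟩
  | succ n ih =>
    intro r B hB hpos
    refine ⟨fun hn hn2 hcr hs h2 hc => ?_, fun hn hr hs hc => ?_⟩
    · suffices h : ∃ a b U, B = a ::ₘ b ::ₘ U ∧ a + b ≠ r ∧ r ∉ U ∧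
          (4 ≤ n → ∀ h, 2 ≤ h → h + h = r → ((a + b) ::ₘ U).count h ≤ 2) by
        obtain ⟨a, b, U, rfl, h1, h3, h4⟩ := h
        refine .blue ⟨a, b, U, rfl, rfl⟩ ((ih r _ (by simpa using hB) ?_).2 (by omega) ?_ ?_
          fun h => h4 (by omega))
        · intro x hx
          rcases Multiset.mem_cons.1 hx with rfl | hx
          · have := hpos a (by simp)
            omega
          · exact hpos x (by simp [hx])
        · simp only [Multiset.mem_cons, not_or]
          exact ⟨fun h => h1 h.symm, h3⟩
        · simpa [add_assoc] using hs
      by_cases hr : r ∈ B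
      · obtain ⟨U, rfl⟩ := Multiset.exists_cons_of_mem hr
        have hrU : r ∉ U := by
          rw [← Multiset.count_eq_zero]
          simpa using hcr
        have : ∃ b ∈ U, 4 ≤ n → ∀ h, 2 ≤ h → h + h = r → (U.erase b).count h ≤ 2 := by
          by_cases hex : ∃ h, 2 ≤ h ∧ h + h = r ∧ h ∈ U
          · obtain ⟨h, h2, hhr, hU⟩ := hex
            refine ⟨h, hU, fun hn h' _ hhr' => ?_⟩
            obtain rfl : h' = h := by omega
            have := hc (by omega) h' h2 hhr
            rw [Multiset.count_cons_of_ne (by omega)] at this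
            rw [Multiset.count_erase_self]
            omega
          · push Not at hex
            obtain ⟨b, hb⟩ := Multiset.card_pos_iff_exists_mem.1
              (by simp only [Multiset.card_cons] at hB; omega : 0 < U.card)
            refine ⟨b, hb, fun _ h h2 hhr => ?_⟩
            rw [Multiset.count_eq_zero_of_notMem fun hm =>
              hex h h2 hhr (Multiset.mem_of_mem_erase hm)]
            omega
        obtain ⟨b, hbU, hb⟩ := this
        have hb1 := hpos b (by simp [hbU])
        refine ⟨r, b, U.erase b, by rw [Multiset.cons_erase hbU], by omega,
          fun h => hrU (Multiset.mem_of_mem_erase h), fun h4 h h2 hhr => ?_⟩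
        rw [Multiset.count_cons_of_ne (by omega)]
        exact hb h4 h h2 hhr
      · by_cases hex : 4 ≤ n + 1 ∧ ∃ h, 2 ≤ h ∧ h + h = r ∧ h ∈ B
        · obtain ⟨hn4, h, hh2, hhr, hhB⟩ := hex
          obtain ⟨U, rfl⟩ := Multiset.exists_cons_of_mem hhB
          have hcU := hc hn4 h hh2 hhr
          rw [Multiset.count_cons_self] at hcU
          simp only [Multiset.card_cons] at hB
          have : ∃ b ∈ U, b ≠ h := by
            by_contra! hall
            have := Multiset.count_eq_card.2 fun x hx => (hall x hx).symm
            omega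
          obtain ⟨b, hbU, hbh⟩ := this
          have hb1 := hpos b (by simp [hbU])
          refine ⟨h, b, U.erase b, by rw [Multiset.cons_erase hbU], by omega,
            fun h => hr (by simp [Multiset.mem_of_mem_erase h]), fun h4 h' h2 hhr' => ?_⟩
          obtain rfl : h' = h := by omega
          rw [Multiset.count_cons_of_ne (by omega), Multiset.count_erase_of_ne (by omega)]
          omega
        · have hcount : 4 ≤ n → ∀ h, 2 ≤ h → h + h = r → B.count h = 0 := fun h4 h h2 hhr =>
            Multiset.count_eq_zero_of_notMem fun hm => hex ⟨by omega, h, h2, hhr, hm⟩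
          have : ∃ a b U, B = a ::ₘ b ::ₘ U ∧ a + b ≠ r := by
            rcases Nat.lt_or_ge (n + 1) 4 with h4 | h4
            · obtain ⟨a, b, rfl⟩ := Multiset.card_eq_two.1 (by omega : B.card = 2)
              exact ⟨a, b, 0, rfl, fun h => hs (by simp [h])⟩
            · by_cases hr2 : r = 2
              · obtain ⟨b, hbB, hb⟩ := h2 hr2
                obtain ⟨U, rfl⟩ := Multiset.exists_cons_of_mem hbB
                simp only [Multiset.card_cons] at hB
                obtain ⟨c, hcU⟩ := Multiset.card_pos_iff_exists_mem.1 (by omega : 0 < U.card)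
                have hc1 := hpos c (by simp [hcU])
                exact ⟨b, c, U.erase c, by rw [Multiset.cons_erase hcU], by omega⟩
              · refine exists_pair_sum_ne (by omega) fun h hm hhr => ?_
                have := hpos h hm
                exact hex ⟨h4, h, by omega, hhr, hm⟩
          obtain ⟨a, b, U, rfl, hab⟩ := this
          refine ⟨a, b, U, rfl, hab, fun h => hr (by simp [h]), fun h4 h h2 hhr => ?_⟩
          have h0 := hcount h4 h h2 hhr
          have hle : U.count h ≤ 0 := by
            rw [← h0]
            exact Multiset.count_le_of_le _ ((Multiset.le_cons_self _ _).trans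
              (Multiset.le_cons_self _ _))
          rw [Multiset.count_cons]
          split_ifs <;> omega
    · refine .intro _ _ (fun R' hm => ?_) (fun B' hm => ?_) (fun s R' B' h1 h2 => ?_)
        (fun s R' B' h1 h2 => ?_)
      · have := hm.card
        obtain ⟨a, b, U, h, rfl⟩ := hm
        simp at this
      · obtain ⟨a, b, U, rfl, rfl⟩ := hm
        have ha := hpos a (by simp)
        have hb := hpos b (by simp)
        have hrU : r ∉ U := fun h => hr (by simp [h])
        simp only [Multiset.card_cons] at hB
        refine (ih r _ (by simpa using hB) ?_).1 (by omega) (by omega) ?_ ?_ ?_ ?_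
        · intro x hx
          rcases Multiset.mem_cons.1 hx with rfl | hx
          · omega
          · exact hpos x (by simp [hx])
        · rw [Multiset.count_cons, Multiset.count_eq_zero_of_notMem hrU]
          split_ifs <;> omega
        · simpa [add_assoc] using hs
        · exact fun _ => ⟨a + b, by simp, by omega⟩
        · intro h4 h h2 hhr
          have := hc (by omega) h h2 hhr
          simp only [Multiset.count_cons] at this ⊢
          split_ifs at this ⊢ <;> omega
      · obtain ⟨rfl, -⟩ : r = s ∧ _ := by
          rcases Multiset.cons_eq_cons.1 h1 with h | ⟨_, _, h, _⟩
          · exact h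
          · simp at h
        exact absurd (h2 ▸ Multiset.mem_cons_self _ _) hr
      · obtain ⟨rfl, -⟩ : r = s ∧ _ := by
          rcases Multiset.cons_eq_cons.1 h1 with h | ⟨_, _, h, _⟩
          · exact h
          · simp at h
        exact absurd (h2 ▸ Multiset.mem_cons_self _ _) hr

/-- A single red stack wins for the player to move, against an even number of blue stacks. -/
theorem win_single {r : ℕ} {B : Multiset ℕ} (hpos : ∀ b ∈ B, 1 ≤ b) (hn : B.card % 2 = 0)
    (hn2 : 2 ≤ B.card) (hcr : B.count r ≤ 1) (hs : r ≠ B.sum) (h2 : r = 2 → ∃ b ∈ B, 2 ≤ b)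
    (hc : 4 ≤ B.card → ∀ h, 2 ≤ h → h + h = r → B.count h ≤ 3) : Win (r ::ₘ 0) B :=
  (single_aux _ r B rfl hpos).1 hn hn2 hcr hs h2 hc

/-- A single red stack loses for the player to move, against an odd number of blue stacks. -/
theorem lose_single {r : ℕ} {B : Multiset ℕ} (hpos : ∀ b ∈ B, 1 ≤ b) (hn : B.card % 2 = 1)
    (hr : r ∉ B) (hs : r ≠ B.sum)
    (hc : 5 ≤ B.card → ∀ h, 2 ≤ h → h + h = r → B.count h ≤ 2) : Lose (r ::ₘ 0) B :=
  (single_aux _ r B rfl hpos).2 hn hr hs hc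

/-! ### Two red stacks against many blue stacks -/

theorem lose_pair_aux (n : ℕ) : ∀ (x u : ℕ) (B : Multiset ℕ), B.card = n →
    (∀ b ∈ B, 1 ≤ b) → 1 ≤ x → 1 ≤ u → n % 2 = 0 → 2 ≤ n → x ∉ B → u ∉ B → x + u ∉ B →
    x + u ≠ B.sum → (∀ h, 2 ≤ h → h + h = x + u → B.count h ≤ 1) →
    Lose (x ::ₘ u ::ₘ 0) B := by
  induction n using Nat.strong_induction_on with
  | _ n ih =>
    intro x u B hB hpos hx1 hu1 hn hn2 hx hu hxu hs hc
    have hmix : ∀ s R' B', x ::ₘ u ::ₘ 0 = s ::ₘ R' → B ≠ s ::ₘ B' := by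
      rintro s R' B' h1 rfl
      have : s ∈ x ::ₘ u ::ₘ (0 : Multiset ℕ) := h1 ▸ Multiset.mem_cons_self s R'
      simp only [Multiset.mem_cons, Multiset.notMem_zero, or_false] at this
      rcases this with rfl | rfl
      · exact hx (by simp)
      · exact hu (by simp)
    refine .intro _ _ (fun R' hm => ?_) (fun B' hm => ?_)
      (fun s R' B' h1 h2 => absurd h2 (hmix _ _ _ h1))
      (fun s R' B' h1 h2 => absurd h2 (hmix _ _ _ h1))
    · have hR' : R' = (x + u) ::ₘ 0 := by
        have hcard := hm.card
        obtain ⟨a, b, U, h, rfl⟩ := hm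
        simp only [Multiset.card_cons, Multiset.card_zero] at hcard
        obtain rfl : U = 0 := Multiset.card_eq_zero.1 (by omega)
        have := congrArg Multiset.sum h
        simp only [Multiset.sum_cons, Multiset.sum_zero] at this
        rw [show a + b = x + u by omega]
      subst hR'
      refine win_single hpos (by omega) (by omega) ?_ hs ?_ ?_
      · rw [Multiset.count_eq_zero_of_notMem hxu]
        omega
      · intro h2
        obtain ⟨b, hb⟩ := Multiset.card_pos_iff_exists_mem.1 (by omega : 0 < B.card)
        refine ⟨b, hb, ?_⟩
        have := hpos b hb
        have : b ≠ 1 := by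
          rintro rfl
          exact hx ((show x = 1 by omega) ▸ hb)
        omega
      · exact fun _ h h2 hh => (hc h h2 hh).trans (by omega)
    · obtain ⟨a, b, U, rfl, rfl⟩ := hm
      have ha := hpos a (by simp)
      have hb := hpos b (by simp)
      have hxuU : x + u ∉ U := fun h => hxu (by simp [h])
      simp only [Multiset.card_cons] at hB
      have hcU : ∀ h, 2 ≤ h → h + h = x + u → U.count h ≤ 1 := fun h h2 hh =>
        (Multiset.count_le_of_le _ ((Multiset.le_cons_self _ _).trans
          (Multiset.le_cons_self _ _))).trans (hc h h2 hh)
      by_cases hab : a + b = x + u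
      · have hU : 0 < U.card := by
          rcases Nat.eq_zero_or_pos U.card with h0 | h0
          · obtain rfl := Multiset.card_eq_zero.1 h0
            simp [hab] at hs
          · exact h0
        obtain ⟨c, U, rfl⟩ := Multiset.card_pos_iff_exists_mem.1 hU |>.imp
          fun a ha => Multiset.exists_cons_of_mem ha
        have hc1 := hpos c (by simp)
        simp only [Multiset.card_cons] at hB
        refine .blue ⟨a + b, c, U, rfl, rfl⟩ (ih (n - 2) (by omega) x u _
          (by simp only [Multiset.card_cons]; omega) ?_ hx1 hu1 (by omega)
          (by rcases U.card.eq_zero_or_pos with h | h <;> omega) ?_ ?_ ?_ ?_ ?_)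
        · intro y hy
          rcases Multiset.mem_cons.1 hy with rfl | hy
          · omega
          · exact hpos y (by simp [hy])
        · simp only [Multiset.mem_cons, not_or] at hx ⊢
          exact ⟨by omega, hx.2.2.2⟩
        · simp only [Multiset.mem_cons, not_or] at hu ⊢
          exact ⟨by omega, hu.2.2.2⟩
        · simp only [Multiset.mem_cons, not_or] at hxu ⊢
          exact ⟨by omega, hxu.2.2.2⟩
        · simpa [add_assoc] using hs
        · intro h h2 hh
          have := hcU h h2 hh
          rw [Multiset.count_cons] at this
          rw [Multiset.count_cons_of_ne (by omega)]
          omega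
      · refine .red ⟨x, u, 0, rfl, rfl⟩ (lose_single ?_ ?_ ?_ ?_ ?_)
        · intro y hy
          rcases Multiset.mem_cons.1 hy with rfl | hy
          · omega
          · exact hpos y (by simp [hy])
        · simp only [Multiset.card_cons]
          omega
        · simp only [Multiset.mem_cons, not_or]
          exact ⟨fun h => hab h.symm, hxuU⟩
        · simpa [add_assoc] using hs
        · intro _ h h2 hh
          have := hcU h h2 hh
          rw [Multiset.count_cons]
          split_ifs <;> omega

theorem lose_pair {x u : ℕ} {B : Multiset ℕ} (hpos : ∀ b ∈ B, 1 ≤ b) (hx1 : 1 ≤ x)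
    (hu1 : 1 ≤ u) (hn : B.card % 2 = 0) (hn2 : 2 ≤ B.card) (hx : x ∉ B) (hu : u ∉ B)
    (hxu : x + u ∉ B) (hs : x + u ≠ B.sum)
    (hc : ∀ h, 2 ≤ h → h + h = x + u → B.count h ≤ 1) : Lose (x ::ₘ u ::ₘ 0) B :=
  lose_pair_aux _ x u B rfl hpos hx1 hu1 hn hn2 hx hu hxu hs hc

/-! ### Stacks of height one, and single moves on explicit multisets -/

/-- `n` stacks of height one. -/
def ones (n : ℕ) : Multiset ℕ := Multiset.replicate n 1

theorem ones_succ (n : ℕ) : ones (n + 1) = 1 ::ₘ ones n := Multiset.replicate_succ 1 n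

theorem count_ones (t n : ℕ) : (ones n).count t = if 1 = t then n else 0 :=
  Multiset.count_replicate t 1 n

theorem card_ones (n : ℕ) : (ones n).card = n := Multiset.card_replicate n 1

theorem sum_ones (n : ℕ) : (ones n).sum = n := by simp [ones]

theorem mem_ones {t n : ℕ} : t ∈ ones n ↔ n ≠ 0 ∧ t = 1 := Multiset.mem_replicate

theorem merge_of_cons {a b : ℕ} {S T : Multiset ℕ} (ha : 1 ≤ a) (hb : 1 ≤ b)
    (h : (a + b) ::ₘ S = a ::ₘ b ::ₘ T) : Merge S T := by
  rcases Multiset.cons_eq_cons.1 h with ⟨h1, -⟩ | ⟨-, U, rfl, h2⟩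
  · omega
  · rcases Multiset.cons_eq_cons.1 h2 with ⟨h1, -⟩ | ⟨-, V, rfl, rfl⟩
    · omega
    · exact ⟨a, b, V, rfl, rfl⟩

theorem Win.byRed {R B T : Multiset ℕ} (a b : ℕ) (h : Lose T B)
    (e : (a + b) ::ₘ R = a ::ₘ b ::ₘ T := by
      ext t; simp only [Multiset.count_cons, count_ones] <;> split_ifs <;> omega)
    (ha : 1 ≤ a := by omega) (hb : 1 ≤ b := by omega) : Win R B :=
  .red (merge_of_cons ha hb e) h

theorem Win.byBlue {R B T : Multiset ℕ} (a b : ℕ) (h : Lose R T)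
    (e : (a + b) ::ₘ B = a ::ₘ b ::ₘ T := by
      ext t; simp only [Multiset.count_cons, count_ones] <;> split_ifs <;> omega)
    (ha : 1 ≤ a := by omega) (hb : 1 ≤ b := by omega) : Win R B :=
  .blue (merge_of_cons ha hb e) h

theorem Win.byMixRed {R B T U : Multiset ℕ} (s : ℕ) (h : Lose T U)
    (e : (s + s) ::ₘ R = s ::ₘ T := by
      ext t; simp only [Multiset.count_cons, count_ones] <;> split_ifs <;> omega)
    (eb : B = s ::ₘ U := by
      ext t; simp only [Multiset.count_cons, count_ones] <;> split_ifs <;> omega)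
    (hs : 1 ≤ s := by omega) : Win R B := by
  rcases Multiset.cons_eq_cons.1 e with ⟨h1, -⟩ | ⟨-, V, rfl, rfl⟩
  · omega
  · exact .mixRed s rfl eb h

theorem Win.byMixBlue {R B T U : Multiset ℕ} (s : ℕ) (h : Lose T U)
    (e : (s + s) ::ₘ B = s ::ₘ U := by
      ext t; simp only [Multiset.count_cons, count_ones] <;> split_ifs <;> omega)
    (eb : R = s ::ₘ T := by
      ext t; simp only [Multiset.count_cons, count_ones] <;> split_ifs <;> omega)
    (hs : 1 ≤ s := by omega) : Win R B := by
  rcases Multiset.cons_eq_cons.1 e with ⟨h1, -⟩ | ⟨-, V, rfl, rfl⟩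
  · omega
  · exact .mixBlue s eb rfl h

/-! ### The outcome of single red stacks and pairs of red stacks, in coordinates -/

theorem lose_single1 (r u n : ℕ)
    (h : 2 ≤ r ∧ 1 ≤ u ∧ (1 + n) % 2 = 1 ∧ r ≠ u ∧ r ≠ u + n := by omega) :
    Lose (r ::ₘ ones 0) (u ::ₘ ones n) := by
  refine lose_single (fun b hb => ?_) ?_ ?_ ?_ fun _ t h2 ht => ?_
  · simp only [Multiset.mem_cons, mem_ones] at hb
    rcases hb with rfl | ⟨-, rfl⟩ <;> omega
  · simp only [Multiset.card_cons, card_ones]; omega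
  · simp only [Multiset.mem_cons, mem_ones]; omega
  · simp only [Multiset.sum_cons, sum_ones]; omega
  · clear h; simp only [Multiset.count_cons, count_ones]; split_ifs <;> omega

theorem lose_single2 (r u v n : ℕ)
    (h : 2 ≤ r ∧ 1 ≤ u ∧ 1 ≤ v ∧ (2 + n) % 2 = 1 ∧ r ≠ u ∧ r ≠ v ∧ r ≠ u + v + n := by omega) :
    Lose (r ::ₘ ones 0) (u ::ₘ v ::ₘ ones n) := by
  refine lose_single (fun b hb => ?_) ?_ ?_ ?_ fun _ t h2 ht => ?_
  · simp only [Multiset.mem_cons, mem_ones] at hb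
    rcases hb with rfl | rfl | ⟨-, rfl⟩ <;> omega
  · simp only [Multiset.card_cons, card_ones]; omega
  · simp only [Multiset.mem_cons, mem_ones]; omega
  · simp only [Multiset.sum_cons, sum_ones]; omega
  · clear h; simp only [Multiset.count_cons, count_ones]; split_ifs <;> omega

theorem lose_single3 (r u v w n : ℕ)
    (h : 2 ≤ r ∧ 1 ≤ u ∧ 1 ≤ v ∧ 1 ≤ w ∧ (3 + n) % 2 = 1 ∧ r ≠ u ∧ r ≠ v ∧ r ≠ w ∧
      r ≠ u + v + w + n ∧ (n ≤ 1 ∨ ¬(u + u = r ∧ v + v = r ∧ w + w = r)) := by omega) :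
    Lose (r ::ₘ ones 0) (u ::ₘ v ::ₘ w ::ₘ ones n) := by
  obtain ⟨g0, g1, g2, g3, g4, g5, g6, g7, g8, h3⟩ := h
  refine lose_single (fun b hb => ?_) ?_ ?_ ?_ fun h5 t h2 ht => ?_
  · clear h3
    simp only [Multiset.mem_cons, mem_ones] at hb
    rcases hb with rfl | rfl | rfl | ⟨-, rfl⟩ <;> omega
  · clear h3
    simp only [Multiset.card_cons, card_ones]; omega
  · clear h3
    simp only [Multiset.mem_cons, mem_ones]; omega
  · clear h3
    simp only [Multiset.sum_cons, sum_ones]; omega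
  · simp only [Multiset.card_cons, card_ones] at h5
    simp only [Multiset.count_cons, count_ones]; grind

theorem lose_single4 (r u v w z n : ℕ)
    (h : 2 ≤ r ∧ 1 ≤ u ∧ 1 ≤ v ∧ 1 ≤ w ∧ 1 ≤ z ∧ (4 + n) % 2 = 1 ∧ r ≠ u ∧ r ≠ v ∧ r ≠ w ∧ r ≠ z ∧
      r ≠ u + v + w + z + n ∧ ¬(u + u = r ∧ v + v = r ∧ w + w = r) ∧
      ¬(u + u = r ∧ v + v = r ∧ z + z = r) ∧ ¬(u + u = r ∧ w + w = r ∧ z + z = r) ∧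
      ¬(v + v = r ∧ w + w = r ∧ z + z = r) := by omega) :
    Lose (r ::ₘ ones 0) (u ::ₘ v ::ₘ w ::ₘ z ::ₘ ones n) := by
  obtain ⟨g0, g1, g2, g3, g4, g5, g6, g7, g8, g9, g10, h3, h4, h5, h6⟩ := h
  refine lose_single (fun b hb => ?_) ?_ ?_ ?_ fun _ t h2 ht => ?_
  · clear h3 h4 h5 h6
    simp only [Multiset.mem_cons, mem_ones] at hb
    rcases hb with rfl | rfl | rfl | rfl | ⟨-, rfl⟩ <;> omega
  · clear h3 h4 h5 h6
    simp only [Multiset.card_cons, card_ones]; omega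
  · clear h3 h4 h5 h6
    simp only [Multiset.mem_cons, mem_ones]; omega
  · clear h3 h4 h5 h6
    simp only [Multiset.sum_cons, sum_ones]; omega
  · simp only [Multiset.count_cons, count_ones]; grind

theorem win_single1 (r u n : ℕ)
    (h : 2 ≤ r ∧ 1 ≤ u ∧ (1 + n) % 2 = 0 ∧ 2 ≤ 1 + n ∧ r ≠ u + n ∧ (r = 2 → 2 ≤ u) := by omega) :
    Win (r ::ₘ ones 0) (u ::ₘ ones n) := by
  refine win_single (fun b hb => ?_) ?_ ?_ ?_ ?_ (fun h2 => ?_) fun _ t h2 ht => ?_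
  · simp only [Multiset.mem_cons, mem_ones] at hb
    rcases hb with rfl | ⟨-, rfl⟩ <;> omega
  · simp only [Multiset.card_cons, card_ones]; omega
  · simp only [Multiset.card_cons, card_ones]; omega
  · simp only [Multiset.count_cons, count_ones]; split_ifs <;> omega
  · simp only [Multiset.sum_cons, sum_ones]; omega
  · exact ⟨u, by simp, by omega⟩
  · clear h; simp only [Multiset.count_cons, count_ones]; split_ifs <;> omega

theorem win_single2 (r u v n : ℕ)
    (h : 2 ≤ r ∧ 1 ≤ u ∧ 1 ≤ v ∧ (2 + n) % 2 = 0 ∧ 2 ≤ 2 + n ∧ ¬(u = r ∧ v = r) ∧ r ≠ u + v + n ∧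
      (r = 2 → 2 ≤ u ∨ 2 ≤ v) := by omega) :
    Win (r ::ₘ ones 0) (u ::ₘ v ::ₘ ones n) := by
  refine win_single (fun b hb => ?_) ?_ ?_ ?_ ?_ (fun h2 => ?_) fun _ t h2 ht => ?_
  · simp only [Multiset.mem_cons, mem_ones] at hb
    rcases hb with rfl | rfl | ⟨-, rfl⟩ <;> omega
  · simp only [Multiset.card_cons, card_ones]; omega
  · simp only [Multiset.card_cons, card_ones]; omega
  · simp only [Multiset.count_cons, count_ones]; split_ifs <;> omega
  · simp only [Multiset.sum_cons, sum_ones]; omega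
  · obtain h2 | h2 : 2 ≤ u ∨ 2 ≤ v := by omega
    · exact ⟨u, by simp, h2⟩
    · exact ⟨v, by simp, h2⟩
  · clear h; simp only [Multiset.count_cons, count_ones]; split_ifs <;> omega

theorem win_single3 (r u v w n : ℕ)
    (h : 2 ≤ r ∧ 1 ≤ u ∧ 1 ≤ v ∧ 1 ≤ w ∧ (3 + n) % 2 = 0 ∧ 2 ≤ 3 + n ∧ ¬(u = r ∧ v = r) ∧
      ¬(u = r ∧ w = r) ∧ ¬(v = r ∧ w = r) ∧ r ≠ u + v + w + n ∧
      (r = 2 → 2 ≤ u ∨ 2 ≤ v ∨ 2 ≤ w) := by omega) :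
    Win (r ::ₘ ones 0) (u ::ₘ v ::ₘ w ::ₘ ones n) := by
  refine win_single (fun b hb => ?_) ?_ ?_ ?_ ?_ (fun h2 => ?_) fun _ t h2 ht => ?_
  · simp only [Multiset.mem_cons, mem_ones] at hb
    rcases hb with rfl | rfl | rfl | ⟨-, rfl⟩ <;> omega
  · simp only [Multiset.card_cons, card_ones]; omega
  · simp only [Multiset.card_cons, card_ones]; omega
  · simp only [Multiset.count_cons, count_ones]; split_ifs <;> omega
  · simp only [Multiset.sum_cons, sum_ones]; omega
  · obtain h2 | h2 | h2 : 2 ≤ u ∨ 2 ≤ v ∨ 2 ≤ w := by omega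
    · exact ⟨u, by simp, h2⟩
    · exact ⟨v, by simp, h2⟩
    · exact ⟨w, by simp, h2⟩
  · clear h; simp only [Multiset.count_cons, count_ones]; split_ifs <;> omega

theorem win_single4 (r u v w z n : ℕ)
    (h : 2 ≤ r ∧ 1 ≤ u ∧ 1 ≤ v ∧ 1 ≤ w ∧ 1 ≤ z ∧ (4 + n) % 2 = 0 ∧ 2 ≤ 4 + n ∧ ¬(u = r ∧ v = r) ∧
      ¬(u = r ∧ w = r) ∧ ¬(u = r ∧ z = r) ∧ ¬(v = r ∧ w = r) ∧ ¬(v = r ∧ z = r) ∧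
      ¬(w = r ∧ z = r) ∧ r ≠ u + v + w + z + n ∧ (r = 2 → 2 ≤ u ∨ 2 ≤ v ∨ 2 ≤ w ∨ 2 ≤ z) ∧
      ¬(u + u = r ∧ v + v = r ∧ w + w = r ∧ z + z = r) := by omega) :
    Win (r ::ₘ ones 0) (u ::ₘ v ::ₘ w ::ₘ z ::ₘ ones n) := by
  obtain ⟨g0, g1, g2, g3, g4, g5, g6, g7, g8, g9, g10, g11, g12, g13, g14, h3⟩ := h
  refine win_single (fun b hb => ?_) ?_ ?_ ?_ ?_ (fun h2 => ?_) fun _ t h2 ht => ?_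
  · clear h3
    simp only [Multiset.mem_cons, mem_ones] at hb
    rcases hb with rfl | rfl | rfl | rfl | ⟨-, rfl⟩ <;> omega
  · clear h3
    simp only [Multiset.card_cons, card_ones]; omega
  · clear h3
    simp only [Multiset.card_cons, card_ones]; omega
  · clear h3
    simp only [Multiset.count_cons, count_ones]; split_ifs <;> omega
  · clear h3
    simp only [Multiset.sum_cons, sum_ones]; omega
  · clear h3
    obtain h2 | h2 | h2 | h2 : 2 ≤ u ∨ 2 ≤ v ∨ 2 ≤ w ∨ 2 ≤ z := by omega
    · exact ⟨u, by simp, h2⟩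
    · exact ⟨v, by simp, h2⟩
    · exact ⟨w, by simp, h2⟩
    · exact ⟨z, by simp, h2⟩
  · simp only [Multiset.count_cons, count_ones]; grind

theorem lose_pair1 (x y u n : ℕ)
    (h : 1 ≤ x ∧ 1 ≤ y ∧ 1 ≤ u ∧ (1 + n) % 2 = 0 ∧ (n = 0 ∨ 2 ≤ x ∧ 2 ≤ y) ∧ 2 ≤ 1 + n ∧ x ≠ u ∧
      y ≠ u ∧ x + y ≠ u ∧ x + y ≠ u + n := by omega) :
    Lose (x ::ₘ y ::ₘ ones 0) (u ::ₘ ones n) := by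
  refine lose_pair (fun b hb => ?_) (by omega) (by omega) ?_ ?_ ?_ ?_ ?_ ?_ fun t h2 ht => ?_
  · simp only [Multiset.mem_cons, mem_ones] at hb
    rcases hb with rfl | ⟨-, rfl⟩ <;> omega
  · simp only [Multiset.card_cons, card_ones]; omega
  · simp only [Multiset.card_cons, card_ones]; omega
  · simp only [Multiset.mem_cons, mem_ones]; omega
  · simp only [Multiset.mem_cons, mem_ones]; omega
  · simp only [Multiset.mem_cons, mem_ones]; omega
  · simp only [Multiset.sum_cons, sum_ones]; omega
  · clear h; simp only [Multiset.count_cons, count_ones]; split_ifs <;> omega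

theorem lose_pair2 (x y u v n : ℕ)
    (h : 1 ≤ x ∧ 1 ≤ y ∧ 1 ≤ u ∧ 1 ≤ v ∧ (2 + n) % 2 = 0 ∧ (n = 0 ∨ 2 ≤ x ∧ 2 ≤ y) ∧ 2 ≤ 2 + n ∧
      x ≠ u ∧ y ≠ u ∧ x + y ≠ u ∧ x ≠ v ∧ y ≠ v ∧ x + y ≠ v ∧ x + y ≠ u + v + n ∧
      ¬(u + u = x + y ∧ v + v = x + y) := by omega) :
    Lose (x ::ₘ y ::ₘ ones 0) (u ::ₘ v ::ₘ ones n) := by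
  obtain ⟨g0, g1, g2, g3, g4, g5, g6, g7, g8, g9, g10, g11, g12, g13, h3⟩ := h
  refine lose_pair (fun b hb => ?_) (by omega) (by omega) ?_ ?_ ?_ ?_ ?_ ?_ fun t h2 ht => ?_
  · clear h3
    simp only [Multiset.mem_cons, mem_ones] at hb
    rcases hb with rfl | rfl | ⟨-, rfl⟩ <;> omega
  · clear h3
    simp only [Multiset.card_cons, card_ones]; omega
  · clear h3
    simp only [Multiset.card_cons, card_ones]; omega
  · clear h3
    simp only [Multiset.mem_cons, mem_ones]; omega
  · clear h3
    simp only [Multiset.mem_cons, mem_ones]; omega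
  · clear h3
    simp only [Multiset.mem_cons, mem_ones]; omega
  · clear h3
    simp only [Multiset.sum_cons, sum_ones]; omega
  · simp only [Multiset.count_cons, count_ones]; grind

theorem lose_pair3 (x y u v w n : ℕ)
    (h : 1 ≤ x ∧ 1 ≤ y ∧ 1 ≤ u ∧ 1 ≤ v ∧ 1 ≤ w ∧ (3 + n) % 2 = 0 ∧ (n = 0 ∨ 2 ≤ x ∧ 2 ≤ y) ∧
      2 ≤ 3 + n ∧ x ≠ u ∧ y ≠ u ∧ x + y ≠ u ∧ x ≠ v ∧ y ≠ v ∧ x + y ≠ v ∧ x ≠ w ∧ y ≠ w ∧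
      x + y ≠ w ∧ x + y ≠ u + v + w + n ∧ ¬(u + u = x + y ∧ v + v = x + y) ∧
      ¬(u + u = x + y ∧ w + w = x + y) ∧ ¬(v + v = x + y ∧ w + w = x + y) := by omega) :
    Lose (x ::ₘ y ::ₘ ones 0) (u ::ₘ v ::ₘ w ::ₘ ones n) := by
  obtain ⟨g0, g1, g2, g3, g4, g5, g6, g7, g8, g9, g10, g11, g12, g13, g14, g15, g16, g17, h3, h4, h5⟩ := h
  refine lose_pair (fun b hb => ?_) (by omega) (by omega) ?_ ?_ ?_ ?_ ?_ ?_ fun t h2 ht => ?_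
  · clear h3 h4 h5
    simp only [Multiset.mem_cons, mem_ones] at hb
    rcases hb with rfl | rfl | rfl | ⟨-, rfl⟩ <;> omega
  · clear h3 h4 h5
    simp only [Multiset.card_cons, card_ones]; omega
  · clear h3 h4 h5
    simp only [Multiset.card_cons, card_ones]; omega
  · clear h3 h4 h5
    simp only [Multiset.mem_cons, mem_ones]; omega
  · clear h3 h4 h5
    simp only [Multiset.mem_cons, mem_ones]; omega
  · clear h3 h4 h5
    simp only [Multiset.mem_cons, mem_ones]; omega
  · clear h3 h4 h5
    simp only [Multiset.sum_cons, sum_ones]; omega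
  · simp only [Multiset.count_cons, count_ones]; grind

/-! ### The moves from explicit multisets -/

theorem cons_inv {x s : ℕ} {S T : Multiset ℕ} (h : x ::ₘ S = s ::ₘ T) :
    (s = x ∧ T = S) ∨ ∃ V, S = s ::ₘ V ∧ T = x ::ₘ V := by
  rcases Multiset.cons_eq_cons.1 h with ⟨rfl, rfl⟩ | ⟨-, V, hV, hT⟩
  · exact .inl ⟨rfl, rfl⟩
  · exact .inr ⟨V, hV, hT⟩

theorem ones_inv {n s : ℕ} {T : Multiset ℕ} (h : ones n = s ::ₘ T) :
    1 ≤ n ∧ s = 1 ∧ T = ones (n - 1) := by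
  have hs := mem_ones.1 (h ▸ Multiset.mem_cons_self s T)
  obtain ⟨n, rfl⟩ := Nat.exists_eq_succ_of_ne_zero hs.1
  obtain rfl := hs.2
  refine ⟨by omega, rfl, ?_⟩
  rw [Nat.succ_eq_add_one, ones_succ] at h
  exact ((Multiset.cons_inj_right 1).1 h).symm

theorem Merge.cons_inv {x : ℕ} {S T : Multiset ℕ} (h : Merge (x ::ₘ S) T) :
    (∃ a V, S = a ::ₘ V ∧ T = (x + a) ::ₘ V) ∨ ∃ V, Merge S V ∧ T = x ::ₘ V := by
  obtain ⟨a, b, U, k, rfl⟩ := h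
  rcases _root_.cons_inv k with ⟨rfl, rfl⟩ | ⟨V, rfl, hV⟩
  · exact .inl ⟨b, U, rfl, rfl⟩
  · rcases _root_.cons_inv hV.symm with ⟨rfl, rfl⟩ | ⟨W, rfl, rfl⟩
    · exact .inl ⟨a, U, rfl, by rw [add_comm]⟩
    · exact .inr ⟨(a + b) ::ₘ W, ⟨a, b, W, rfl, rfl⟩, Multiset.cons_swap _ _ _⟩

theorem Merge.ones_inv {n : ℕ} {T : Multiset ℕ} (h : Merge (ones n) T) :
    2 ≤ n ∧ T = 2 ::ₘ ones (n - 2) := by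
  obtain ⟨a, b, U, k, rfl⟩ := h
  obtain ⟨h1, rfl, h2⟩ := _root_.ones_inv k
  obtain ⟨h3, rfl, rfl⟩ := _root_.ones_inv h2.symm
  exact ⟨by omega, rfl⟩

theorem Merge.inv1 {x n : ℕ} {T : Multiset ℕ} (h : Merge (x ::ₘ ones n) T) :
    (1 ≤ n ∧ T = (x + 1) ::ₘ ones (n - 1)) ∨ (2 ≤ n ∧ T = x ::ₘ 2 ::ₘ ones (n - 2)) := by
  rcases h.cons_inv with ⟨a, V, k, rfl⟩ | ⟨V, k, rfl⟩
  · obtain ⟨k₂, rfl, rfl⟩ := _root_.ones_inv k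
    exact .inl ⟨k₂, rfl⟩
  · obtain ⟨k₂, rfl⟩ := k.ones_inv
    exact .inr ⟨k₂, rfl⟩

theorem Merge.inv2 {x y n : ℕ} {T : Multiset ℕ} (h : Merge (x ::ₘ y ::ₘ ones n) T) :
    T = (x + y) ::ₘ ones n ∨ (1 ≤ n ∧ T = (x + 1) ::ₘ y ::ₘ ones (n - 1)) ∨
      (1 ≤ n ∧ T = x ::ₘ (y + 1) ::ₘ ones (n - 1)) ∨
      (2 ≤ n ∧ T = x ::ₘ y ::ₘ 2 ::ₘ ones (n - 2)) := by
  rcases h.cons_inv with ⟨a, V, k, rfl⟩ | ⟨V, k, rfl⟩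
  · rcases _root_.cons_inv k with ⟨rfl, rfl⟩ | ⟨W, k₂, rfl⟩
    · exact .inl rfl
    · obtain ⟨k₃, rfl, rfl⟩ := _root_.ones_inv k₂
      exact .inr (.inl ⟨k₃, rfl⟩)
  · rcases k.inv1 with ⟨k₂, rfl⟩ | ⟨k₂, rfl⟩
    · exact .inr (.inr (.inl ⟨k₂, rfl⟩))
    · exact .inr (.inr (.inr ⟨k₂, rfl⟩))

theorem pick1 {x n s : ℕ} {T : Multiset ℕ} (h : x ::ₘ ones n = s ::ₘ T) :
    (s = x ∧ (x = 1 → n = 0) ∧ T = ones n) ∨ (s = 1 ∧ 1 ≤ n ∧ T = x ::ₘ ones (n - 1)) := by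
  rcases cons_inv h with ⟨rfl, rfl⟩ | ⟨V, k, rfl⟩
  · by_cases hs : s = 1 ∧ 1 ≤ n
    · obtain ⟨rfl, hn⟩ := hs
      refine .inr ⟨rfl, hn, ?_⟩
      rw [← ones_succ, Nat.sub_add_cancel hn]
    · exact .inl ⟨rfl, by omega, rfl⟩
  · obtain ⟨k₂, rfl, rfl⟩ := ones_inv k
    exact .inr ⟨rfl, k₂, rfl⟩

theorem pick2 {x y n s : ℕ} {T : Multiset ℕ} (h : x ::ₘ y ::ₘ ones n = s ::ₘ T) :
    (s = x ∧ (x = 1 → n = 0) ∧ T = y ::ₘ ones n) ∨ (s = y ∧ (y = 1 → n = 0) ∧ T = x ::ₘ ones n) ∨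
      (s = 1 ∧ 1 ≤ n ∧ T = x ::ₘ y ::ₘ ones (n - 1)) := by
  rcases cons_inv h with ⟨rfl, rfl⟩ | ⟨V, k, rfl⟩
  · by_cases hs : s = 1 ∧ 1 ≤ n
    · obtain ⟨rfl, hn⟩ := hs
      refine .inr (.inr ⟨rfl, hn, ?_⟩)
      rw [Multiset.cons_swap, ← ones_succ, Nat.sub_add_cancel hn]
    · exact .inl ⟨rfl, by omega, rfl⟩
  · rcases pick1 k with ⟨rfl, k₂, rfl⟩ | ⟨rfl, k₂, rfl⟩
    · exact .inr (.inl ⟨rfl, k₂, rfl⟩)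
    · exact .inr (.inr ⟨rfl, k₂, rfl⟩)

theorem Lose.intro11 {x n y m : ℕ} (hn : 1 ≤ n) (hm : 1 ≤ m)
    (r1 : Win ((x + 1) ::ₘ ones (n - 1)) (y ::ₘ ones m))
    (r2 : 2 ≤ n → Win (x ::ₘ 2 ::ₘ ones (n - 2)) (y ::ₘ ones m))
    (b1 : Win (x ::ₘ ones n) ((y + 1) ::ₘ ones (m - 1)))
    (b2 : 2 ≤ m → Win (x ::ₘ ones n) (y ::ₘ 2 ::ₘ ones (m - 2)))
    (mr1 : Win (2 ::ₘ x ::ₘ ones (n - 1)) (y ::ₘ ones (m - 1)))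
    (mb1 : Win (x ::ₘ ones (n - 1)) (2 ::ₘ y ::ₘ ones (m - 1)))
    (mr : x = y → x ≠ 1 → Win ((x + x) ::ₘ ones n) (ones m) := by omega)
    (mb : x = y → x ≠ 1 → Win (ones n) ((x + x) ::ₘ ones m) := by omega) :
    Lose (x ::ₘ ones n) (y ::ₘ ones m) := by
  have pick : ∀ s R' B', x ::ₘ ones n = s ::ₘ R' → y ::ₘ ones m = s ::ₘ B' →
      Win ((s + s) ::ₘ R') B' ∧ Win R' ((s + s) ::ₘ B') := by
    intro s R' B' hR hB
    rcases pick1 hR with ⟨h1, h2, rfl⟩ | ⟨h1, h2, rfl⟩ <;>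
      rcases pick1 hB with ⟨h3, h4, rfl⟩ | ⟨h3, h4, rfl⟩ <;> try omega
    · subst h1
      exact ⟨mr h3 (by omega), mb h3 (by omega)⟩
    · subst h1
      exact ⟨mr1, mb1⟩
  refine .intro _ _ (fun R' h => ?_) (fun B' h => ?_) (fun s R' B' hR hB => (pick s R' B' hR hB).1)
    fun s R' B' hR hB => (pick s R' B' hR hB).2
  · rcases h.inv1 with ⟨k, rfl⟩ | ⟨k, rfl⟩
    exacts [r1, r2 k]
  · rcases h.inv1 with ⟨k, rfl⟩ | ⟨k, rfl⟩
    exacts [b1, b2 k]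

theorem Lose.intro12 {x n u v m : ℕ} (hn : 1 ≤ n) (hm : 1 ≤ m)
    (r1 : Win ((x + 1) ::ₘ ones (n - 1)) (u ::ₘ v ::ₘ ones m))
    (b1 : Win (x ::ₘ ones n) ((u + v) ::ₘ ones m))
    (b2 : Win (x ::ₘ ones n) ((u + 1) ::ₘ v ::ₘ ones (m - 1)))
    (b3 : Win (x ::ₘ ones n) (u ::ₘ (v + 1) ::ₘ ones (m - 1)))
    (b4 : 2 ≤ m → Win (x ::ₘ ones n) (u ::ₘ v ::ₘ 2 ::ₘ ones (m - 2)))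
    (mr1 : Win (2 ::ₘ x ::ₘ ones (n - 1)) (u ::ₘ v ::ₘ ones (m - 1)))
    (mb1 : Win (x ::ₘ ones (n - 1)) (2 ::ₘ u ::ₘ v ::ₘ ones (m - 1)))
    (r2 : 2 ≤ n → Win (x ::ₘ 2 ::ₘ ones (n - 2)) (u ::ₘ v ::ₘ ones m) := by omega)
    (mru : x = u → x ≠ 1 → Win ((x + x) ::ₘ ones n) (v ::ₘ ones m) := by omega)
    (mbu : x = u → x ≠ 1 → Win (ones n) ((x + x) ::ₘ v ::ₘ ones m) := by omega)
    (mrv : x = v → x ≠ 1 → Win ((x + x) ::ₘ ones n) (u ::ₘ ones m) := by omega)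
    (mbv : x = v → x ≠ 1 → Win (ones n) ((x + x) ::ₘ u ::ₘ ones m) := by omega) :
    Lose (x ::ₘ ones n) (u ::ₘ v ::ₘ ones m) := by
  have pick : ∀ s R' B', x ::ₘ ones n = s ::ₘ R' → u ::ₘ v ::ₘ ones m = s ::ₘ B' →
      Win ((s + s) ::ₘ R') B' ∧ Win R' ((s + s) ::ₘ B') := by
    intro s R' B' hR hB
    rcases pick1 hR with ⟨h1, h2, rfl⟩ | ⟨h1, h2, rfl⟩ <;>
      rcases pick2 hB with ⟨h3, h4, rfl⟩ | ⟨h3, h4, rfl⟩ | ⟨h3, h4, rfl⟩ <;> try omega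
    · subst h1
      exact ⟨mru h3 (by omega), mbu h3 (by omega)⟩
    · subst h1
      exact ⟨mrv h3 (by omega), mbv h3 (by omega)⟩
    · subst h1
      exact ⟨mr1, mb1⟩
  refine .intro _ _ (fun R' h => ?_) (fun B' h => ?_) (fun s R' B' hR hB => (pick s R' B' hR hB).1)
    fun s R' B' hR hB => (pick s R' B' hR hB).2
  · rcases h.inv1 with ⟨k, rfl⟩ | ⟨k, rfl⟩
    exacts [r1, r2 k]
  · rcases h.inv2 with rfl | ⟨k, rfl⟩ | ⟨k, rfl⟩ | ⟨k, rfl⟩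
    exacts [b1, b2, b3, b4 k]

theorem Lose.intro22 {x y n u v m : ℕ} (hx : 2 ≤ x) (hy : 2 ≤ y) (hm : 1 ≤ m)
    (r1 : Win ((x + y) ::ₘ ones n) (u ::ₘ v ::ₘ ones m))
    (b1 : Win (x ::ₘ y ::ₘ ones n) ((u + v) ::ₘ ones m))
    (b2 : Win (x ::ₘ y ::ₘ ones n) ((u + 1) ::ₘ v ::ₘ ones (m - 1)))
    (b3 : Win (x ::ₘ y ::ₘ ones n) (u ::ₘ (v + 1) ::ₘ ones (m - 1)))
    (b4 : 2 ≤ m → Win (x ::ₘ y ::ₘ ones n) (u ::ₘ v ::ₘ 2 ::ₘ ones (m - 2)))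
    (r2 : 1 ≤ n → Win ((x + 1) ::ₘ y ::ₘ ones (n - 1)) (u ::ₘ v ::ₘ ones m) := by omega)
    (r3 : 1 ≤ n → Win (x ::ₘ (y + 1) ::ₘ ones (n - 1)) (u ::ₘ v ::ₘ ones m) := by omega)
    (r4 : 2 ≤ n → Win (x ::ₘ y ::ₘ 2 ::ₘ ones (n - 2)) (u ::ₘ v ::ₘ ones m) := by omega)
    (mr1 : 1 ≤ n →
      Win (2 ::ₘ x ::ₘ y ::ₘ ones (n - 1)) (u ::ₘ v ::ₘ ones (m - 1)) := by omega)
    (mb1 : 1 ≤ n →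
      Win (x ::ₘ y ::ₘ ones (n - 1)) (2 ::ₘ u ::ₘ v ::ₘ ones (m - 1)) := by omega)
    (mrxu : x = u → Win ((x + x) ::ₘ y ::ₘ ones n) (v ::ₘ ones m) := by omega)
    (mbxu : x = u → Win (y ::ₘ ones n) ((x + x) ::ₘ v ::ₘ ones m) := by omega)
    (mrxv : x = v → Win ((x + x) ::ₘ y ::ₘ ones n) (u ::ₘ ones m) := by omega)
    (mbxv : x = v → Win (y ::ₘ ones n) ((x + x) ::ₘ u ::ₘ ones m) := by omega)
    (mryu : y = u → Win ((y + y) ::ₘ x ::ₘ ones n) (v ::ₘ ones m) := by omega)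
    (mbyu : y = u → Win (x ::ₘ ones n) ((y + y) ::ₘ v ::ₘ ones m) := by omega)
    (mryv : y = v → Win ((y + y) ::ₘ x ::ₘ ones n) (u ::ₘ ones m) := by omega)
    (mbyv : y = v → Win (x ::ₘ ones n) ((y + y) ::ₘ u ::ₘ ones m) := by omega) :
    Lose (x ::ₘ y ::ₘ ones n) (u ::ₘ v ::ₘ ones m) := by
  have pick : ∀ s R' B', x ::ₘ y ::ₘ ones n = s ::ₘ R' → u ::ₘ v ::ₘ ones m = s ::ₘ B' →
      Win ((s + s) ::ₘ R') B' ∧ Win R' ((s + s) ::ₘ B') := by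
    intro s R' B' hR hB
    rcases pick2 hR with ⟨h1, h2, rfl⟩ | ⟨h1, h2, rfl⟩ | ⟨h1, h2, rfl⟩ <;>
      rcases pick2 hB with ⟨h3, h4, rfl⟩ | ⟨h3, h4, rfl⟩ | ⟨h3, h4, rfl⟩ <;> try omega
    all_goals subst h1
    exacts [⟨mrxu h3, mbxu h3⟩, ⟨mrxv h3, mbxv h3⟩, ⟨mryu h3, mbyu h3⟩, ⟨mryv h3, mbyv h3⟩,
      ⟨mr1 h2, mb1 h2⟩]
  refine .intro _ _ (fun R' h => ?_) (fun B' h => ?_) (fun s R' B' hR hB => (pick s R' B' hR hB).1)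
    fun s R' B' hR hB => (pick s R' B' hR hB).2
  · rcases h.inv2 with rfl | ⟨k, rfl⟩ | ⟨k, rfl⟩ | ⟨k, rfl⟩
    exacts [r1, r2 k, r3 k, r4 k]
  · rcases h.inv2 with rfl | ⟨k, rfl⟩ | ⟨k, rfl⟩ | ⟨k, rfl⟩
    exacts [b1, b2, b3, b4 k]

theorem Lose.intro13 {x u m : ℕ} (hx : 3 ≤ x) (hu : x ≠ u) (hm : 1 ≤ m)
    (r1 : Win ((x + 1) ::ₘ ones 0) (u ::ₘ 2 ::ₘ 2 ::ₘ ones m))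
    (b1 : Win (x ::ₘ ones 1) ((u + 2) ::ₘ 2 ::ₘ ones m))
    (b2 : Win (x ::ₘ ones 1) ((u + 1) ::ₘ 2 ::ₘ 2 ::ₘ ones (m - 1)))
    (b3 : Win (x ::ₘ ones 1) (u ::ₘ 4 ::ₘ ones m))
    (b4 : Win (x ::ₘ ones 1) (u ::ₘ 3 ::ₘ 2 ::ₘ ones (m - 1)))
    (b5 : 2 ≤ m → Win (x ::ₘ ones 1) (u ::ₘ 2 ::ₘ 2 ::ₘ 2 ::ₘ ones (m - 2)))
    (mr1 : Win (2 ::ₘ x ::ₘ ones 0) (u ::ₘ 2 ::ₘ 2 ::ₘ ones (m - 1)))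
    (mb1 : Win (x ::ₘ ones 0) (2 ::ₘ u ::ₘ 2 ::ₘ 2 ::ₘ ones (m - 1))) :
    Lose (x ::ₘ ones 1) (u ::ₘ 2 ::ₘ 2 ::ₘ ones m) := by
  have pick : ∀ s R' B', x ::ₘ ones 1 = s ::ₘ R' → u ::ₘ 2 ::ₘ 2 ::ₘ ones m = s ::ₘ B' →
      Win ((s + s) ::ₘ R') B' ∧ Win R' ((s + s) ::ₘ B') := by
    intro s R' B' hR hB
    rcases pick1 hR with ⟨rfl, h2, rfl⟩ | ⟨rfl, h2, rfl⟩
    · have : s ∈ u ::ₘ 2 ::ₘ 2 ::ₘ ones m := hB ▸ Multiset.mem_cons_self s B'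
      simp only [Multiset.mem_cons, mem_ones] at this
      omega
    · have : B' = u ::ₘ 2 ::ₘ 2 ::ₘ ones (m - 1) := by
        refine (Multiset.cons_inj_right 1).1 (hB.symm.trans ?_)
        ext t; simp only [Multiset.count_cons, count_ones]; split_ifs <;> omega
      subst this
      exact ⟨mr1, mb1⟩
  refine .intro _ _ (fun R' h => ?_) (fun B' h => ?_) (fun s R' B' hR hB => (pick s R' B' hR hB).1)
    fun s R' B' hR hB => (pick s R' B' hR hB).2
  · rcases h.inv1 with ⟨k, rfl⟩ | ⟨k, rfl⟩
    · exact r1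
    · omega
  · rcases h.cons_inv with ⟨a, V, k, rfl⟩ | ⟨V, k, rfl⟩
    · rcases pick2 k with ⟨rfl, -, rfl⟩ | ⟨rfl, -, rfl⟩ | ⟨rfl, -, rfl⟩
      exacts [b1, b1, b2]
    · rcases k.inv2 with rfl | ⟨k₂, rfl⟩ | ⟨k₂, rfl⟩ | ⟨k₂, rfl⟩
      exacts [b3, b4, by rw [Multiset.cons_swap 2]; exact b4, b5 k₂]

/-! ### A decision procedure for small positions -/

/-- The ways to take one member out of a list. -/
def picks : List ℕ → List (ℕ × List ℕ)
  | [] => []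
  | x :: S => (x, S) :: (picks S).map fun p => (p.1, x :: p.2)

/-- The ways to add up two members of a list. -/
def merges : List ℕ → List (List ℕ)
  | [] => []
  | x :: S => ((picks S).map fun p => (x + p.1) :: p.2) ++ (merges S).map (x :: ·)

/-- The positions reachable in one move from the position with heights `R` and `B`. -/
def nexts (R B : List ℕ) : List (List ℕ × List ℕ) :=
  (merges R).map (·, B) ++ (merges B).map (R, ·) ++
    (picks R).flatMap fun p => (picks B).flatMap fun q =>
      if p.1 = q.1 then [((p.1 + p.1) :: p.2, q.2), (p.2, (p.1 + p.1) :: q.2)] else []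

/-- Search for a winning move, with at most `n` moves ahead. -/
def search : ℕ → List ℕ → List ℕ → Bool
  | 0, _, _ => false
  | n + 1, R, B => (nexts R B).any fun m => !search n m.1 m.2

theorem exists_mem_picks {s : ℕ} {T : Multiset ℕ} : ∀ {L : List ℕ}, (L : Multiset ℕ) = s ::ₘ T →
    ∃ V, (s, V) ∈ picks L ∧ T = V
  | [], h => (Multiset.zero_ne_cons h).elim
  | x :: S, h => by
    rcases cons_inv (show x ::ₘ (S : Multiset ℕ) = s ::ₘ T from h) with ⟨rfl, rfl⟩ | ⟨V, k, rfl⟩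
    · exact ⟨S, by simp [picks], rfl⟩
    · obtain ⟨W, hW, rfl⟩ := exists_mem_picks k
      exact ⟨x :: W, by simp [picks, hW], rfl⟩

theorem of_mem_picks {s : ℕ} {V : List ℕ} : ∀ {L : List ℕ}, (s, V) ∈ picks L →
    (L : Multiset ℕ) = s ::ₘ (V : Multiset ℕ)
  | [], h => by simp [picks] at h
  | x :: S, h => by
    simp only [picks, List.mem_cons, List.mem_map, Prod.mk.injEq, Prod.exists] at h
    rcases h with ⟨rfl, rfl⟩ | ⟨a, W, h, rfl, rfl⟩
    · rfl
    · rw [← Multiset.cons_coe, of_mem_picks h, ← Multiset.cons_coe, Multiset.cons_swap]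

theorem exists_mem_merges {T : Multiset ℕ} : ∀ {L : List ℕ}, Merge L T →
    ∃ V ∈ merges L, T = (V : Multiset ℕ)
  | [], h => by simpa using h.card
  | x :: S, h => by
    rcases Merge.cons_inv (show Merge (x ::ₘ (S : Multiset ℕ)) T from h) with
      ⟨a, V, k, rfl⟩ | ⟨V, k, rfl⟩
    · obtain ⟨W, hW, rfl⟩ := exists_mem_picks k
      exact ⟨(x + a) :: W, List.mem_append_left _ (List.mem_map.2 ⟨_, hW, rfl⟩), rfl⟩
    · obtain ⟨W, hW, rfl⟩ := exists_mem_merges k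
      exact ⟨x :: W, List.mem_append_right _ (List.mem_map.2 ⟨_, hW, rfl⟩), rfl⟩

theorem of_mem_merges {V : List ℕ} : ∀ {L : List ℕ}, V ∈ merges L → Merge L (V : Multiset ℕ)
  | [], h => by simp [merges] at h
  | x :: S, h => by
    simp only [merges, List.mem_append, List.mem_map, Prod.exists] at h
    rcases h with ⟨a, W, h, rfl⟩ | ⟨W, h, rfl⟩
    · refine ⟨x, a, W, ?_, rfl⟩
      rw [← Multiset.cons_coe, of_mem_picks h]
    · obtain ⟨a, b, U, h1, h2⟩ := of_mem_merges h
      refine ⟨a, b, x ::ₘ U, ?_, ?_⟩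
      · rw [← Multiset.cons_coe, h1, Multiset.cons_swap x, Multiset.cons_swap x]
      · rw [← Multiset.cons_coe, h2, Multiset.cons_swap]

theorem win_iff_search (n : ℕ) : ∀ R B : List ℕ, R.length + B.length ≤ n →
    (search n R B = true → Win R B) ∧ (search n R B = false → Lose R B) := by
  induction n with
  | zero =>
    intro R B h
    obtain rfl := List.length_eq_zero_iff.1 (show R.length = 0 by omega)
    obtain rfl := List.length_eq_zero_iff.1 (show B.length = 0 by omega)
    refine ⟨by simp [search], fun _ => .intro _ _ (fun R' h => ?_) (fun R' h => ?_) ?_ ?_⟩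
    · simpa using h.card
    · simpa using h.card
    · intro s R' B' h
      exact (Multiset.zero_ne_cons h).elim
    · intro s R' B' h
      exact (Multiset.zero_ne_cons h).elim
  | succ n ih =>
    intro R B hn
    refine ⟨fun h => ?_, fun h => ?_⟩
    · obtain ⟨⟨R', B'⟩, hm, hs⟩ := List.any_eq_true.1 h
      simp only [Bool.not_eq_true'] at hs
      simp only [nexts, List.mem_append, List.mem_map, List.mem_flatMap, Prod.exists,
        Prod.mk.injEq] at hm
      rcases hm with (⟨V, hV, rfl, rfl⟩ | ⟨V, hV, rfl, rfl⟩) | ⟨s, V, hV, t, W, hW, hm⟩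
      · have hm := of_mem_merges hV
        refine .red hm ((ih _ _ ?_).2 hs)
        have := hm.card
        simp only [Multiset.coe_card] at this; omega
      · have hm := of_mem_merges hV
        refine .blue hm ((ih _ _ ?_).2 hs)
        have := hm.card
        simp only [Multiset.coe_card] at this; omega
      · have e1 := of_mem_picks hV
        have e2 := of_mem_picks hW
        have c1 := congrArg Multiset.card e1
        have c2 := congrArg Multiset.card e2
        simp only [Multiset.coe_card, Multiset.card_cons] at c1 c2
        split_ifs at hm with hst
        · subst hst
          simp only [List.mem_cons, Prod.mk.injEq, List.not_mem_nil, or_false] at hm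
          rcases hm with ⟨rfl, rfl⟩ | ⟨rfl, rfl⟩
          · exact .mixRed s e1 e2 ((ih _ _ (by simp only [List.length_cons]; omega)).2 hs)
          · exact .mixBlue s e1 e2 ((ih _ _ (by simp only [List.length_cons]; omega)).2 hs)
        · simp at hm
    · have key : ∀ m ∈ nexts R B, m.1.length + m.2.length ≤ n → Win m.1 m.2 := by
        intro m hm hl
        refine (ih _ _ hl).1 ?_
        simpa using List.any_eq_false.1 h m hm
      have hmix : ∀ s R' B', (R : Multiset ℕ) = s ::ₘ R' → (B : Multiset ℕ) = s ::ₘ B' →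
          Win ((s + s) ::ₘ R') B' ∧ Win R' ((s + s) ::ₘ B') := by
        intro s R' B' hR hB
        have c1 := congrArg Multiset.card hR
        have c2 := congrArg Multiset.card hB
        obtain ⟨V, hV, rfl⟩ := exists_mem_picks hR
        obtain ⟨W, hW, rfl⟩ := exists_mem_picks hB
        simp only [Multiset.coe_card, Multiset.card_cons] at c1 c2
        have hm : ∀ m ∈ [((s + s) :: V, W), (V, (s + s) :: W)], m ∈ nexts R B := fun m hm =>
          List.mem_append_right _ (List.mem_flatMap.2 ⟨_, hV, List.mem_flatMap.2 ⟨_, hW, by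
            simpa using hm⟩⟩)
        exact ⟨key ((s + s) :: V, W) (hm _ (by simp)) (by simp only [List.length_cons]; omega),
          key (V, (s + s) :: W) (hm _ (by simp)) (by simp only [List.length_cons]; omega)⟩
      refine .intro _ _ (fun R' hm => ?_) (fun B' hm => ?_)
        (fun s R' B' hR hB => (hmix s R' B' hR hB).1) fun s R' B' hR hB => (hmix s R' B' hR hB).2
      · have := hm.card
        obtain ⟨V, hV, rfl⟩ := exists_mem_merges hm
        simp only [Multiset.coe_card] at this
        exact key (V, B) (by simp [nexts, hV]) (by dsimp only; omega)
      · have := hm.card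
        obtain ⟨V, hV, rfl⟩ := exists_mem_merges hm
        simp only [Multiset.coe_card] at this
        exact key (R, V) (by simp [nexts, hV]) (by dsimp only; omega)

theorem lose_of_search (R B : List ℕ) (h : search (R.length + B.length) R B = false := by decide) :
    Lose R B :=
  (win_iff_search _ R B le_rfl).2 h

/-! ### Families of lost positions -/

theorem lose_one_two {x y m : ℕ}
    (h : 1 ≤ y ∧ 2 ≤ m ∧ m % 2 = 0 ∧ x + 1 = y + m ∧ 3 ≤ x) :
    Lose (x ::ₘ ones 1) (y ::ₘ 2 ::ₘ ones m) := by
  refine .intro12 le_rfl (by omega) ?_ ?_ ?_ ?_ ?_ ?_ ?_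
  · exact win_single2 (x + 1) y 2 m
  · by_cases hm : m = 2
    · exact .byMixBlue 1 (lose_single2 x (x + 1) 2 1)
    · exact .byRed x 1 (lose_single1 (x + 1) (y + 2) m)
  · exact .byRed x 1 (lose_single2 (x + 1) (y + 1) 2 (m - 1))
  · exact .byRed x 1 (lose_single2 (x + 1) y 3 (m - 1))
  · exact fun _ => .byRed x 1 (lose_single3 (x + 1) y 2 2 (m - 2))
  · by_cases hx : x = 4
    · exact .byMixRed 2 (lose_pair1 4 4 y (m - 1))
    · exact .byMixBlue 2 (lose_single2 x y 4 (m - 1))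
  · exact win_single3 x 2 y 2 (m - 1)

theorem lose_one_one {x u m : ℕ}
    (h : m % 2 = 1 ∧ 2 ≤ x ∧ 1 ≤ u ∧ x ≠ u ∧ x + 2 ≠ u ∧ x + 1 ≠ u + m ∧ x ≠ u + m + 1 ∧
      (x + 3 = u + m → u = 2) ∧ (x = 2 → 5 ≤ u)) :
    Lose (x ::ₘ ones 1) (u ::ₘ ones m) := by
  refine .intro11 le_rfl (by omega) ?_ (fun h => by omega) ?_ ?_ ?_ ?_
  · exact win_single1 (x + 1) u m
  · exact .byRed x 1 (lose_single1 (x + 1) (u + 1) (m - 1))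
  · intro hm
    by_cases hu : x + 1 = u
    · exact .byMixBlue 1 (lose_single3 x u 2 2 (m - 3))
    · exact .byRed x 1 (lose_single2 (x + 1) u 2 (m - 2))
  · by_cases hu : x + 3 = u + m
    · exact .byMixRed 2 (lose_pair1 4 x 1 (m - 2))
    · exact .byRed x 2 (lose_single1 (x + 2) u (m - 1))
  · exact win_single2 x 2 u (m - 1)

theorem lose_two_two {x y n : ℕ}
    (h : 1 ≤ y ∧ 2 ≤ x ∧ n % 2 = 0 ∧ 2 ≤ n ∧ x + 2 = y + n) :
    Lose (x ::ₘ 2 ::ₘ ones 0) (y ::ₘ 2 ::ₘ ones n) := by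
  refine .intro22 (by omega) (by omega) (by omega) ?_ ?_ ?_ ?_ ?_ (mrxu := ?_) (mbxu := ?_)
    (mrxv := ?_) (mbxv := ?_) (mryu := ?_) (mbyu := ?_) (mryv := ?_) (mbyv := ?_)
  · exact win_single2 (x + 2) y 2 n
  · by_cases hy : x = y
    · exact .byBlue (y + 2) 1 (lose_pair1 x 2 (x + 3) 1)
    · exact .byRed x 2 (lose_single1 (x + 2) (y + 2) n)
  · exact .byRed x 2 (lose_single2 (x + 2) (y + 1) 2 (n - 1))
  · exact .byRed x 2 (lose_single2 (x + 2) y 3 (n - 1))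
  · exact fun _ => .byRed x 2 (lose_single3 (x + 2) y 2 2 (n - 2))
  · exact fun _ => .byRed (x + x) 2 (lose_single1 (x + x + 2) 2 n)
  · exact fun _ => win_single2 2 (x + x) 2 n
  · exact fun _ => .byRed (x + x) 2 (lose_single1 (x + x + 2) y n)
  · exact fun _ => win_single2 2 (x + x) y n
  · exact fun _ => .byRed (2 + 2) x (lose_single1 (x + 4) 2 n)
  · exact fun _ => win_single2 x (2 + 2) 2 n
  · exact fun _ => .byRed (2 + 2) x (lose_single1 (x + 4) y n)
  · intro _
    by_cases hx : x = 4 ∧ y = 4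
    · exact .byBlue (2 + 2) y (lose_single1 x 8 n)
    · exact win_single2 x (2 + 2) y n

theorem lose_one_twos {x y m : ℕ}
    (h : m % 2 = 1 ∧ 1 ≤ y ∧ x = y + m + 1 ∧ x ≠ 4) :
    Lose (x ::ₘ ones 1) (y ::ₘ 2 ::ₘ 2 ::ₘ ones m) := by
  refine .intro13 (by omega) (by omega) (by omega) ?_ ?_ ?_ ?_ ?_ ?_ ?_ ?_
  · exact win_single3 (x + 1) y 2 2 m
  · exact .byRed x 1 (lose_single2 (x + 1) (y + 2) 2 m)
  · exact .byRed x 1 (lose_single3 (x + 1) (y + 1) 2 2 (m - 1))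
  · by_cases hx : x = 3
    · exact .byMixBlue 1 (lose_single2 3 4 2 1)
    · exact .byRed x 1 (lose_single2 (x + 1) y 4 m)
  · exact .byRed x 1 (lose_single3 (x + 1) y 3 2 (m - 1))
  · exact fun _ => .byRed x 1 (lose_single4 (x + 1) y 2 2 2 (m - 2))
  · exact .byMixBlue 2 (lose_single3 x y 4 2 (m - 1))
  · exact win_single4 x 2 y 2 2 (m - 1)

theorem lose_two_one {x y n : ℕ}
    (h : n % 2 = 1 ∧ 5 ≤ n ∧ 1 ≤ y ∧ x + 3 = y + n ∧ y ≠ 2) :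
    Lose (x ::ₘ 2 ::ₘ ones 1) (y ::ₘ 2 ::ₘ ones n) := by
  refine .intro22 (by omega) (by omega) (by omega) ?_ ?_ ?_ ?_ ?_ (r2 := ?_) (r3 := ?_)
    (mr1 := ?_) (mb1 := ?_) (mryv := ?_) (mbyv := ?_)
  · exact .byRed (x + 2) 1 (lose_single2 (x + 3) y 2 n)
  · exact .byRed x 1 (lose_pair1 (x + 1) 2 (y + 2) n)
  · exact .byRed 2 1 (lose_pair2 x 3 (y + 1) 2 (n - 1))
  · exact .byRed x 1 (lose_pair2 (x + 1) 2 y 3 (n - 1))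
  · intro _
    by_cases hy : y = 3
    · exact .byRed x 2 (lose_one_twos (x := x + 2) (y := y) (m := n - 2) (by omega))
    · exact .byRed 2 1 (lose_pair3 x 3 y 2 2 (n - 2))
  · exact fun _ => .byRed (x + 1) 2 (lose_single2 (x + 3) y 2 n)
  · exact fun _ => .byRed x 3 (lose_single2 (x + 3) y 2 n)
  · intro _
    by_cases hy : x = 6 ∧ y = 4
    · obtain ⟨rfl, rfl⟩ := hy
      obtain rfl : n = 5 := by omega
      exact .byMixBlue 2 (show Lose (6 ::ₘ 2 ::ₘ ones 0) (4 ::ₘ 4 ::ₘ ones 4) from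
        lose_of_search [6, 2] [4, 4, 1, 1, 1, 1])
    · exact .byMixBlue 2 (lose_pair2 x 2 y 4 (n - 1))
  · exact fun _ => .byRed x 2 (lose_single3 (x + 2) 2 y 2 (n - 1))
  · intro _
    by_cases hy : y = 4
    · exact .byRed (2 + 2) 1 (lose_pair1 x 5 y n)
    · exact .byRed x 1 (lose_pair1 (x + 1) 4 y n)
  · intro _
    by_cases hx : x = 3
    · exact .byMixBlue 1 (lose_single3 x y 4 2 (n - 1))
    · exact .byRed x 1 (lose_single2 (x + 1) 4 y n)

theorem lose_two_ones {y m : ℕ} (h : 1 ≤ y ∧ y ≠ 2 ∧ m % 2 = 0 ∧ 4 ≤ m) :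
    Lose (2 ::ₘ ones 1) (y ::ₘ 2 ::ₘ ones m) := by
  refine .intro12 le_rfl (by omega) ?_ ?_ ?_ ?_ ?_ ?_ ?_ (mrv := ?_) (mbv := ?_)
  · by_cases hy : y = 1
    · exact .byBlue 1 1 (lose_single3 (2 + 1) y 2 2 (m - 2))
    · exact .byBlue y 2 (lose_single1 (2 + 1) (y + 2) m)
  · exact .byMixRed 1 (lose_pair1 2 2 (y + 2) (m - 1))
  · exact .byRed 2 1 (lose_single2 3 (y + 1) 2 (m - 1))
  · by_cases hy : y = 4
    · exact .byBlue y (2 + 1) (lose_one_one (x := 2) (u := 7) (m := m - 1) (by omega))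
    · exact .byMixRed 1 (lose_pair2 2 2 y 3 (m - 2))
  · intro _
    by_cases hy : y = 3
    · by_cases hm : m = 4
      · subst hy hm
        exact .byBlue 3 2 (show Lose (2 ::ₘ ones 1) (5 ::ₘ 2 ::ₘ ones 2) from
          lose_of_search [2, 1] [5, 2, 1, 1])
      · exact .byBlue y 2 (lose_two_ones (y := 5) (m := m - 2) (by omega))
    · exact .byRed 2 1 (lose_single3 3 y 2 2 (m - 2))
  · exact .byMixBlue 2 (lose_single2 2 y 4 (m - 1))
  · exact .byBlue 2 2 (lose_single2 2 4 y (m - 1))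
  · intro _ _
    by_cases hy : y = 4
    · exact .byRed (2 + 2) 1 (lose_single1 5 y m)
    · exact .byMixBlue 1 (lose_single2 4 y 2 (m - 1))
  · exact fun _ _ => .byMixRed 1 (lose_single2 2 4 y (m - 1))

theorem lose_eq_one_one {y : ℕ} (h : 3 ≤ y) : Lose (y ::ₘ ones 2) (y ::ₘ ones 2) := by
  refine .intro11 (by omega) (by omega) ?_ ?_ ?_ ?_ ?_ ?_ ?_ ?_
  · exact .byMixBlue 1 (lose_single2 (y + 1) y 2 1)
  · exact fun _ => .byMixBlue y (lose_single1 2 (y + y) 2)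
  · exact .byMixRed 1 (lose_single2 (y + 1) y 2 1).symm
  · exact fun _ => .byMixRed y (lose_single1 2 (y + y) 2).symm
  · exact .byBlue y 1 (lose_single2 (y + 1) 2 y 1).symm
  · exact .byRed y 1 (lose_single2 (y + 1) 2 y 1)
  · exact fun _ _ => .byBlue 1 1 (lose_single1 2 (y + y) 2).symm
  · exact fun _ _ => .byRed 1 1 (lose_single1 2 (y + y) 2)

theorem win_two_ones {x y b : ℕ}
    (h : b % 2 = 1 ∧ 2 ≤ x ∧ 1 ≤ y ∧ (x + 2 = y + b → 3 ≤ b))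
    (h3 : y = 2 → 3 ≤ b → x + 2 ≠ y + b → Lose (x ::ₘ ones 2) (3 ::ₘ ones (b - 1))) :
    Win (x ::ₘ ones 2) (y ::ₘ ones b) := by
  by_cases hs : x + 2 = y + b
  · by_cases hx : x = 2
    · obtain rfl : y = 1 := by omega
      obtain rfl : b = 3 := by omega
      subst hx
      exact .byMixBlue 1 (show Lose (2 ::ₘ ones 1) (1 ::ₘ 2 ::ₘ ones 2) from
        lose_of_search [2, 1] [1, 2, 1, 1])
    · exact .byMixBlue 1 (lose_one_two (x := x) (y := y) (m := b - 1) (by omega))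
  by_cases hy : y = 2
  · subst hy
    by_cases hb : b = 1
    · by_cases hx : x = 3
      · subst hx hb
        exact .byRed 1 1 (show Lose (3 ::ₘ 2 ::ₘ ones 0) (2 ::ₘ ones 1) from
          lose_of_search [3, 2] [2, 1])
      · exact .byBlue 2 1 (lose_single1 3 x 2).symm
    · exact .byBlue 2 1 (h3 rfl (by omega) hs)
  by_cases hxy : y = x ∨ y = x + 2
  · exact .byRed x 1 (lose_one_one (x := x + 1) (u := y) (m := b) (by omega))
  · exact .byRed 1 1 (lose_pair1 x 2 y b)

theorem win_two_one {x y b : ℕ} (h : b % 2 = 1 ∧ 2 ≤ x ∧ 1 ≤ y) :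
    Win (x ::ₘ 2 ::ₘ ones 1) (y ::ₘ ones b) := by
  by_cases hs : x + 3 = y + b
  · by_cases hb : b = 1
    · exact .byMixRed 1 (lose_single3 y x 2 2 0).symm
    · exact .byMixBlue 1 (lose_two_two (x := x) (y := y) (n := b - 1) (by omega))
  by_cases hy : y = 2
  · subst hy
    by_cases hx : x = 2
    · subst hx
      by_cases hb : b = 1
      · subst hb
        exact .byRed 2 1 (show Lose (2 ::ₘ 3 ::ₘ ones 0) (2 ::ₘ ones 1) from
          lose_of_search [2, 3] [2, 1])
      · exact .byRed 2 2 (lose_one_one (x := 4) (u := 2) (m := b) (by omega))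
    · exact .byRed 2 1 (lose_pair1 x 3 2 b)
  by_cases hxy : y = x + 1 ∨ y = x + 3
  · exact .byRed x 2 (lose_one_one (x := x + 2) (u := y) (m := b) (by omega))
  · exact .byRed x 1 (lose_pair1 (x + 1) 2 y b)

theorem lose_ones_two {x y c : ℕ}
    (h : 2 ≤ x ∧ 1 ≤ y ∧ c % 2 = 0 ∧ 2 ≤ c ∧ x + 2 ≠ y + c) :
    Lose (x ::ₘ ones 2) (y ::ₘ ones c) := by
  refine .intro11 (by omega) (by omega) ?_ ?_ ?_ ?_ ?_ ?_ ?_ ?_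
  · by_cases hy : y = x + 2
    · exact .byMixBlue 1 (lose_single2 (x + 1) y 2 (c - 1))
    · exact .byRed (x + 1) 1 (lose_single1 (x + 2) y c)
  · intro _
    by_cases hy : y = x + 2
    · exact .byBlue y 1 (lose_pair1 x 2 (y + 1) (c - 1))
    · exact .byRed x 2 (lose_single1 (x + 2) y c)
  · refine win_two_ones (by omega) fun _ _ _ => ?_
    exact lose_ones_two (x := x) (y := 3) (c := c - 2) (by omega)
  · intro _
    by_cases hc : c = 2
    · subst hc
      by_cases hy : y + 2 = x
      · by_cases hy1 : y = 1
        · subst hy1 hy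
          exact .byRed 1 1 (show Lose (3 ::ₘ 2 ::ₘ ones 0) (1 ::ₘ 2 ::ₘ ones 0) from
            lose_of_search [3, 2] [1, 2])
        · exact .byRed x 1 (lose_pair2 (x + 1) 1 y 2 0)
      · exact .byBlue y 2 (lose_single1 (y + 2) x 2).symm
    · exact .byBlue y 2 (lose_ones_two (x := x) (y := y + 2) (c := c - 2) (by omega))
  · rw [Multiset.cons_swap]
    exact win_two_one (by omega)
  · by_cases hxy : x + 1 = y ∨ x = y + c
    · by_cases hx : x = 2
      · subst hx
        exact .byMixRed 2 (lose_one_one (x := 4) (u := y) (m := c - 1) (by omega))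
      · exact .byMixBlue 1 (lose_single3 x y 2 2 (c - 2))
    · exact .byRed x 1 (lose_single2 (x + 1) 2 y (c - 1))
  · intro _ _
    by_cases hc : c = x + x + 2
    · exact .byMixBlue 1 (lose_one_one (x := x + x) (u := 2) (m := c - 1) (by omega))
    · have key := lose_pair1 (x + x) 2 1 (c - 1)
      rw [← ones_succ, Nat.sub_add_cancel (by omega)] at key
      exact .byRed 1 1 key
  · exact fun _ _ => .byRed 1 1 (lose_single1 2 (x + x) c)
termination_by c

theorem lose_ones_three {c : ℕ} (h : c % 2 = 0 ∧ 4 ≤ c) :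
    Lose (1 ::ₘ ones 2) (4 ::ₘ ones c) := by
  have key : Lose (2 ::ₘ ones 1) (4 ::ₘ 2 ::ₘ ones (c - 2)) := by
    by_cases hc : c = 4
    · subst hc
      exact lose_of_search [2, 1] [4, 2, 1, 1]
    · exact lose_two_ones (by omega)
  refine .intro11 (by omega) (by omega) ?_ ?_ ?_ ?_ ?_ ?_
  · exact .byRed 2 1 (lose_single1 3 4 c)
  · exact fun _ => .byRed 2 1 (lose_single1 3 4 c)
  · exact .byRed 1 1 (lose_one_one (x := 2) (u := 5) (m := c - 1) (by omega))
  · exact fun _ => .byRed 1 1 key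
  · exact .byRed 2 1 (lose_one_one (x := 3) (u := 4) (m := c - 1) (by omega))
  · exact .byMixRed 1 key

theorem win_two_ones_two {x y c : ℕ} (h : 1 ≤ x ∧ 1 ≤ y ∧ c % 2 = 0 ∧ 2 ≤ c) :
    Win (x ::ₘ 2 ::ₘ ones 2) (y ::ₘ ones c) := by
  by_cases hs : x + 4 = y + c
  · by_cases hxy : x = y
    · exact .byMixBlue x (lose_ones_two (x := 2) (y := x + x) (c := c) (by omega))
    by_cases hy : y = 2
    · exact .byMixBlue 2 (lose_ones_two (x := x) (y := 4) (c := c) (by omega))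
    by_cases hc : c = 2
    · subst hc
      exact .byRed x 2 (lose_eq_one_one (y := y) (by omega))
    · exact .byMixBlue 1 (lose_two_one (x := x) (y := y) (n := c - 1) (by omega))
  · exact .byRed x 2 (lose_ones_two (x := x + 2) (y := y) (c := c) (by omega))

theorem win_two_even_ones {x y c : ℕ} (h : 1 ≤ x ∧ 1 ≤ y ∧ c % 2 = 0 ∧ 4 ≤ c) :
    Win (2 ::ₘ x ::ₘ ones c) (y ::ₘ ones 2) := by
  by_cases hs : y = x + c
  · exact .byMixRed 1 (lose_one_twos (x := y) (y := x) (m := c - 1) (by omega)).symm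
  by_cases hy : y = 1
  · by_cases hx : x = 2
    · subst hx hy
      exact .byRed 2 2 (lose_ones_three (c := c) (by omega)).symm
    · subst hy
      rw [Multiset.cons_swap]
      exact .byBlue 1 1 (lose_two_ones (y := x) (m := c) (by omega)).symm
  · exact .byRed x 2 (lose_ones_two (x := y) (y := x + 2) (c := c) (by omega)).symm

/-- The positions with at least four stacks of each color, at most one of which is not a singleton,
are lost for the player to move. -/
theorem lose_ones {x a y b : ℕ} (h : 1 ≤ x ∧ 1 ≤ y ∧ 3 ≤ a ∧ 3 ≤ b ∧ (a + b) % 2 = 0) :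
    Lose (x ::ₘ ones a) (y ::ₘ ones b) := by
  have half : ∀ x a y b : ℕ, 1 ≤ x ∧ 1 ≤ y ∧ 3 ≤ a ∧ 3 ≤ b ∧ (a + b) % 2 = 0 →
      (∀ x' a' y' b', 1 ≤ x' ∧ 1 ≤ y' ∧ 3 ≤ a' ∧ 3 ≤ b' ∧ a' + b' + 2 = a + b →
        Lose (x' ::ₘ ones a') (y' ::ₘ ones b')) →
      Win ((x + 1) ::ₘ ones (a - 1)) (y ::ₘ ones b) ∧
      Win (x ::ₘ 2 ::ₘ ones (a - 2)) (y ::ₘ ones b) ∧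
      Win (2 ::ₘ x ::ₘ ones (a - 1)) (y ::ₘ ones (b - 1)) ∧
      (x = y → x ≠ 1 → Win ((x + x) ::ₘ ones a) (ones b)) := by
    intro x a y b h ih
    refine ⟨?_, ?_, ?_, fun hxy hx => ?_⟩
    · by_cases h3 : a = 3
      · subst h3
        refine win_two_ones (by omega) fun _ _ _ => ?_
        exact lose_ones_two (by omega)
      by_cases h4 : a = 4
      · subst h4
        exact .byBlue y 1 (ih (x + 1) 3 (y + 1) (b - 1) (by omega))
      · exact .byRed (x + 1) 1 (ih (x + 2) (a - 2) y b (by omega))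
    · by_cases h3 : a = 3
      · subst h3
        by_cases hx : x = 1
        · subst hx
          rw [Multiset.cons_swap]
          refine win_two_ones (by omega) fun _ _ _ => ?_
          exact lose_ones_two (by omega)
        · exact win_two_one (by omega)
      by_cases h4 : a = 4
      · subst h4
        exact win_two_ones_two (by omega)
      · exact .byRed x 2 (ih (x + 2) (a - 2) y b (by omega))
    · by_cases h3 : a = 3
      · subst h3
        rw [Multiset.cons_swap]
        exact win_two_ones_two (by omega)
      by_cases h4 : b = 3
      · subst h4
        exact win_two_even_ones (by omega)
      · exact .byRed x 2 (ih (x + 2) (a - 1) y (b - 1) (by omega))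
    · by_cases h3 : b = 3
      · subst h3
        exact .byMixBlue 1 (lose_ones_two (x := 2) (y := x + x) (c := a - 1) (by omega)).symm
      by_cases h4 : b = 4
      · subst h4
        exact .byRed (x + x) 1 (ih (x + x + 1) (a - 1) 1 3 (by omega))
      · exact .byBlue 1 1 (ih (x + x) a 2 (b - 2) (by omega))
  have ih : ∀ x' a' y' b', 1 ≤ x' ∧ 1 ≤ y' ∧ 3 ≤ a' ∧ 3 ≤ b' ∧ a' + b' + 2 = a + b →
      Lose (x' ::ₘ ones a') (y' ::ₘ ones b') := fun x' a' y' b' h' => lose_ones (by omega)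
  obtain ⟨r1, r2, r3, r4⟩ := half x a y b h ih
  obtain ⟨b1, b2, b3, b4⟩ := half y b x a (by omega)
    fun x' a' y' b' h' => ih x' a' y' b' (by omega)
  refine .intro11 (by omega) (by omega) r1 (fun _ => r2) b1.symm (fun _ => b2.symm) r3 b3.symm r4 ?_
  intro hxy hx
  subst hxy
  exact (b4 rfl hx).symm
termination_by a + b

theorem lose_three_ones {q : ℕ} (h : q % 2 = 1 ∧ 3 ≤ q) : Lose (ones 3) (ones q) := by
  by_cases h3 : q = 3
  · subst h3
    exact lose_of_search [1, 1, 1] [1, 1, 1]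
  by_cases h5 : q = 5
  · subst h5
    exact lose_of_search [1, 1, 1] [1, 1, 1, 1, 1]
  obtain ⟨n, rfl⟩ : ∃ n, q = n + 1 := ⟨q - 1, by omega⟩
  rw [ones_succ 2, ones_succ n]
  have key : Lose (2 ::ₘ ones 2) (2 ::ₘ ones (n - 2)) := lose_ones_two (by omega)
  refine .intro11 (by omega) (by omega) ?_ ?_ ?_ ?_ ?_ ?_
  · exact .byRed 2 1 (lose_single1 3 1 n)
  · exact fun _ => .byRed 2 1 (lose_single1 3 1 n)
  · exact .byMixRed 1 key
  · exact fun _ => .byMixRed 1 key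
  · exact .byBlue 1 1 key
  · exact .byMixRed 1 (lose_two_ones (y := 1) (m := n - 2) (by omega))

theorem lose_initPos {p q : ℕ} (h : (p + q) % 2 = 0 ∧ 3 ≤ p ∧ p ≤ q) : Lose (ones p) (ones q) := by
  by_cases h3 : p = 3
  · subst h3
    exact lose_three_ones (by omega)
  obtain ⟨m, rfl⟩ : ∃ m, p = m + 1 := ⟨p - 1, by omega⟩
  obtain ⟨n, rfl⟩ : ∃ n, q = n + 1 := ⟨q - 1, by omega⟩
  have := lose_ones (x := 1) (a := m) (y := 1) (b := n)
  rw [← ones_succ, ← ones_succ] at this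
  exact this (by omega)

theorem heights_initPos (p q : ℕ) :
    heights true (initPos p q) = ones p ∧ heights false (initPos p q) = ones q := by
  have map_filter (c d : Bool) (n : ℕ) :
      heights c (Multiset.replicate n [d]) = if d = c then ones n else 0 := by
    induction n with
    | zero => simp [heights, ones]
    | succ n ih =>
      rw [Multiset.replicate_succ]
      by_cases h : d = c
      · rw [heights_cons_self _ (by simp [h]), ih]
        simp [h, ones_succ]
      · rw [heights_cons_of_ne _ (by simp [h]), ih]
        simp [h]
  have heights_add (c : Bool) (P Q : Position) : heights c (P + Q) = heights c P + heights c Q := by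
    simp [heights]
  simp [initPos, heights_add, map_filter]

/-- If `p + q` is even and `3 ≤ p ≤ q`, then the initial two-color Babylon
position with `p` red and `q` blue singletons is not a first-player win:
the second player (Bob) has a winning strategy. -/
theorem bob_wins_even_case (p q : ℕ) (heven : Even (p + q)) (hp : 3 ≤ p)
    (hpq : p ≤ q) : ¬ FirstWin (initPos p q) := by
  obtain ⟨hr, hb⟩ := heights_initPos p q
  refine (firstWinAux_of_heights _ (initPos p q) rfl fun s hs => ?_).1 ?_
  · rcases Multiset.mem_add.1 hs with h | h <;> simp [Multiset.eq_of_mem_replicate h]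
  · rw [hr, hb]
    exact lose_initPos ⟨Nat.even_iff.1 heven, hp, hpq⟩
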